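/- There do not exist elements g, h ∈ ℂ(x,y,z) such that the subfield of ℂ(x,y,z) generated over ℂ by x⁵ + y³ + z², g, and h equals ℂ(x,y,z). That is, the field extension ℂ(x,y,z)/ℂ(e₈) with e₈ = x⁵ + y³ + z² is not rational. -/

import Mathlib

open MvPolynomial

noncomputable section

/-- The field ℂ(x,y,z): fraction field of the polynomial ring in 3 variables. -/
abbrev Fxyz : Type := FractionRing (MvPolynomial (Fin 3) ℂ)

/-- The images of the variables x, y, z in ℂ(x,y,z). -/
def Vx : Fxyz := algebraMap (MvPolynomial (Fin 3) ℂ) Fxyz (X 0)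
def Vy : Fxyz := algebraMap (MvPolynomial (Fin 3) ℂ) Fxyz (X 1)
def Vz : Fxyz := algebraMap (MvPolynomial (Fin 3) ℂ) Fxyz (X 2)

open scoped Polynomial WithZero

/-! ### Order filtration of a discrete valuation -/

/-- `VanishesTo v r f` says that `f` vanishes to order at least `r` along the valuation `v`. -/
def VanishesTo {K : Type*} [Field K] (v : Valuation K ℤᵐ⁰) (r : ℤ) (f : K) : Prop :=
  v f ≤ WithZero.exp (-r)

namespace VanishesTo

variable {K : Type*} [Field K] {v : Valuation K ℤᵐ⁰} {r s : ℤ} {f g : K}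

lemma mono (h : VanishesTo v s f) (hrs : r ≤ s) : VanishesTo v r f :=
  le_trans h (WithZero.exp_le_exp.2 (neg_le_neg hrs))

lemma zero : VanishesTo v r 0 := by simp [VanishesTo]

lemma add (hf : VanishesTo v r f) (hg : VanishesTo v r g) : VanishesTo v r (f + g) :=
  v.map_add_le hf hg

lemma neg (hf : VanishesTo v r f) : VanishesTo v r (-f) := by simpa [VanishesTo] using hf

lemma sub (hf : VanishesTo v r f) (hg : VanishesTo v r g) : VanishesTo v r (f - g) :=
  v.map_sub_le hf hg

lemma mul (hf : VanishesTo v r f) (hg : VanishesTo v s g) : VanishesTo v (r + s) (f * g) := by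
  unfold VanishesTo at *
  rw [map_mul, neg_add, WithZero.exp_add]
  exact mul_le_mul' hf hg

lemma zero_iff : VanishesTo v 0 f ↔ v f ≤ 1 := by simp [VanishesTo]

lemma one_iff : VanishesTo v 1 f ↔ v f < 1 := by
  unfold VanishesTo
  rcases eq_or_ne (v f) 0 with h | h
  · simp [h]
  · rw [← WithZero.exp_log h, ← WithZero.exp_zero, WithZero.exp_le_exp, WithZero.exp_lt_exp]
    omega

lemma pow (hf : VanishesTo v 0 f) (n : ℕ) : VanishesTo v 0 (f ^ n) := by
  rw [zero_iff, map_pow] at *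
  exact pow_le_one' hf n

lemma mul_left (hf : VanishesTo v 0 f) (hg : VanishesTo v r g) : VanishesTo v r (f * g) := by
  simpa using hf.mul hg

lemma sum {ι : Type*} {t : Finset ι} {F : ι → K} (h : ∀ i ∈ t, VanishesTo v r (F i)) :
    VanishesTo v r (∑ i ∈ t, F i) := v.map_sum_le h

lemma of_mul_unit (hu : v g = 1) (h : VanishesTo v r (f * g)) : VanishesTo v r f := by
  simpa [VanishesTo, hu] using h

lemma not_one_of_unit (hu : v g = 1) : ¬ VanishesTo v 1 g := by
  rw [one_iff, hu]; exact lt_irrefl _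

lemma exists_exact (hf : f ≠ 0) : ∃ r, v f = WithZero.exp (-r) := by
  refine ⟨-WithZero.log (v f), ?_⟩
  rw [neg_neg, WithZero.exp_log ((v.ne_zero_iff).2 hf)]

lemma mul_exact_iff (hg : v g = WithZero.exp (-s)) :
    VanishesTo v (r + s) (f * g) ↔ VanishesTo v r f := by
  unfold VanishesTo
  rw [map_mul, hg, neg_add, WithZero.exp_add]
  exact mul_le_mul_iff_left₀ (WithZero.exp_pos)

end VanishesTo

/-! ### Places of a function field with a Poisson bracket -/

/-- A discrete place of `K/k`, together with a Poisson bracket on `K` whose order along the place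
is bounded below by the order `a` of the dual two-form. -/
structure PoissonPlace (k K : Type*) [Field k] [Field K] [Algebra k K] where
  v : Valuation K ℤᵐ⁰
  map_const : ∀ c : k, c ≠ 0 → v (algebraMap k K c) = 1
  bracket : K → Derivation k K K
  anti : ∀ f g, bracket f g = -bracket g f
  a : ℤ
  ord_bracket : ∀ {r s : ℤ} {f g : K}, VanishesTo v r f → VanishesTo v s g →
    VanishesTo v (r + s - 1 - a) (bracket f g)

/-- Evaluation of a polynomial in two variables over `k`. -/
def bieval {k K : Type*} [Field k] [Field K] [Algebra k K] (x y : K) : k[X][X] →+* K :=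
  Polynomial.eval₂RingHom (Polynomial.aeval x : k[X] →ₐ[k] K).toRingHom y

section bieval

variable {k K : Type*} [Field k] [Field K] [Algebra k K] (x y : K)

@[simp] lemma bieval_C (c : k[X]) : bieval x y (Polynomial.C c) = Polynomial.aeval x c := by
  simp [bieval]

@[simp] lemma bieval_X : bieval (k := k) x y Polynomial.X = y := by
  simp [bieval]

lemma derivation_bieval (D : Derivation k K K) (hx : D x = 0) (P : k[X][X]) :
    D (bieval x y P) = bieval x y (Polynomial.derivative P) * D y := by
  have hC (c : k[X]) : D (Polynomial.aeval x c) = 0 := by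
    rw [Derivation.map_aeval, hx, smul_zero]
  induction P using Polynomial.induction_on' with
  | add p q hp hq => simp only [map_add, hp, hq, add_mul]
  | monomial n c =>
    rw [← Polynomial.C_mul_X_pow_eq_monomial, Polynomial.derivative_C_mul_X_pow]
    simp [hC, Derivation.leibniz_pow]
    ring

end bieval

namespace PoissonPlace

variable {k K : Type*} [Field k] [Field K] [Algebra k K] (p : PoissonPlace k K)

lemma bracket_self [CharZero k] (f : K) : p.bracket f f = 0 := by
  have : CharZero K := charZero_of_injective_algebraMap (algebraMap k K).injective
  have h := p.anti f f
  linear_combination (exp := 1) (1 / 2 : K) * h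

lemma ord_const (c : k) : VanishesTo p.v 0 (algebraMap k K c) := by
  rcases eq_or_ne c 0 with rfl | h
  · simpa using VanishesTo.zero
  · rw [VanishesTo.zero_iff, p.map_const c h]

variable {p} {x y : K}

lemma ord_aeval (hx : VanishesTo p.v 0 x) (c : k[X]) : VanishesTo p.v 0 (Polynomial.aeval x c) := by
  rw [Polynomial.aeval_eq_sum_range]
  refine VanishesTo.sum fun i _ => ?_
  rw [Algebra.smul_def]
  exact (p.ord_const _).mul_left (hx.pow i)

lemma ord_bieval (hx : VanishesTo p.v 0 x) (hy : VanishesTo p.v 0 y) (P : k[X][X]) :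
    VanishesTo p.v 0 (bieval x y P) := by
  rw [bieval, Polynomial.coe_eval₂RingHom, Polynomial.eval₂_eq_sum_range]
  exact VanishesTo.sum fun i _ => (ord_aeval hx _).mul_left (hy.pow i)

variable {π : k[X]}

lemma unit_of_isCoprime (hx : VanishesTo p.v 0 x) (hπ : VanishesTo p.v 1 (Polynomial.aeval x π))
    {c : k[X]} (h : IsCoprime π c) : p.v (Polynomial.aeval x c) = 1 := by
  refine le_antisymm (VanishesTo.zero_iff.1 (ord_aeval hx c)) (le_of_not_gt fun hc => ?_)
  obtain ⟨u, w, huw⟩ := h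
  have h1 : VanishesTo p.v 1 (Polynomial.aeval x (u * π + w * c)) := by
    rw [map_add, map_mul, map_mul]
    exact ((ord_aeval hx u).mul_left hπ).add ((ord_aeval hx w).mul_left (VanishesTo.one_iff.2 hc))
  rw [huw, map_one] at h1
  exact VanishesTo.not_one_of_unit p.v.map_one h1

lemma dvd_of_ord_one (hirr : Irreducible π) (hx : VanishesTo p.v 0 x)
    (hπ : VanishesTo p.v 1 (Polynomial.aeval x π)) {c : k[X]}
    (hc : VanishesTo p.v 1 (Polynomial.aeval x c)) : π ∣ c := by
  by_contra h
  exact VanishesTo.not_one_of_unit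
    (unit_of_isCoprime hx hπ ((hirr.coprime_iff_not_dvd).2 h)) hc

lemma ord_bracket_left [CharZero k] (hirr : Irreducible π) (hx : VanishesTo p.v 0 x)
    (hπ : VanishesTo p.v 1 (Polynomial.aeval x π)) {r : ℤ} {f : K} (hf : VanishesTo p.v r f) :
    VanishesTo p.v (r - p.a) (p.bracket x f) := by
  have h := p.ord_bracket hf hπ
  rw [Derivation.map_aeval, smul_eq_mul, mul_comm] at h
  have h2 := VanishesTo.of_mul_unit (unit_of_isCoprime hx hπ hirr.separable) h
  rw [p.anti]
  exact (h2.mono (by omega)).neg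

/-- A polynomial of degree at most `n` in `y` over `k[x]` cannot vanish to order more than `n * a`
unless it is divisible by `π`, when `∂/∂y` lowers orders by at most `a`. -/
lemma C_dvd_of_ord [CharZero k] (hirr : Irreducible π) (hx : VanishesTo p.v 0 x)
    (hπ : VanishesTo p.v 1 (Polynomial.aeval x π)) (hy : VanishesTo p.v 0 y)
    (hu : p.v (p.bracket x y) = 1) (ha : 0 ≤ p.a) (n : ℕ) :
    ∀ P : k[X][X], P.natDegree ≤ n → VanishesTo p.v (n * p.a + 1) (bieval x y P) →
      Polynomial.C π ∣ P := by
  induction n with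
  | zero =>
    intro P hP h
    rw [Polynomial.eq_C_of_natDegree_le_zero hP] at h ⊢
    rw [bieval_C] at h
    exact map_dvd _ (dvd_of_ord_one hirr hx hπ (by simpa using h))
  | succ n ih =>
    intro P hP h
    have hd : Polynomial.C π ∣ Polynomial.derivative P := by
      refine ih _ ((Polynomial.natDegree_derivative_le P).trans (by omega)) ?_
      have h1 := ord_bracket_left hirr hx hπ h
      rw [derivation_bieval _ _ _ (p.bracket_self x)] at h1
      refine (VanishesTo.of_mul_unit hu h1).mono ?_
      push_cast
      linarith
    rw [Polynomial.C_dvd_iff_dvd_coeff] at hd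
    have hs (j : ℕ) : π ∣ P.coeff (j + 1) := by
      have h1 := hd j
      rw [Polynomial.coeff_derivative] at h1
      have h2 : ((j : k[X]) + 1) = Polynomial.C ((j : k) + 1) := by simp
      rw [h2] at h1
      refine ((IsUnit.dvd_mul_right ?_).1 h1)
      exact Polynomial.isUnit_C.2 (isUnit_iff_ne_zero.2 (Nat.cast_add_one_ne_zero j))
    have hQ : Polynomial.C π ∣ P.divX := by
      rw [Polynomial.C_dvd_iff_dvd_coeff]
      intro j
      rw [Polynomial.coeff_divX]
      exact hs j
    have h0 : π ∣ P.coeff 0 := by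
      refine dvd_of_ord_one hirr hx hπ ?_
      obtain ⟨Q, hQ⟩ := hQ
      have e : Polynomial.aeval x (P.coeff 0) =
          bieval x y P - bieval x y Q * y * Polynomial.aeval x π := by
        conv_rhs => rw [← Polynomial.divX_mul_X_add P, hQ]
        simp
        ring
      rw [e]
      refine (h.mono ?_).sub (((ord_bieval hx hy Q).mul_left hy).mul_left hπ)
      have : 0 ≤ ((n + 1 : ℕ) : ℤ) * p.a := by positivity
      linarith
    rw [Polynomial.C_dvd_iff_dvd_coeff]
    rintro (_ | j)
    · exact h0
    · exact hs j

/-- Taylor expansion along a rational curve: if the derivative of `φ G` is a combination of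
values of `φ` at polynomials whose orders are at least that of `G` minus `b`, then vanishing
of `G` to order `r * b + 1` forces `φ G` to vanish to order `r + 1`. -/
lemma X_pow_dvd_of_ord {κ R : Type*} [Field κ] [CharZero κ] [CommRing R] {b : ℤ} (hb : 0 ≤ b)
    (e : R →+* K) (φ : R →+* κ[X])
    (h0 : ∀ G, VanishesTo p.v 1 (e G) → Polynomial.X ∣ φ G)
    (hd : ∀ G, ∃ G₁ G₂ : R, ∃ c₁ c₂ : κ[X],
      Polynomial.derivative (φ G) = c₁ * φ G₁ + c₂ * φ G₂ ∧
      ∀ r, VanishesTo p.v r (e G) → VanishesTo p.v (r - b) (e G₁) ∧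
        VanishesTo p.v (r - b) (e G₂)) (r : ℕ) :
    ∀ G, VanishesTo p.v (r * b + 1) (e G) → Polynomial.X ^ (r + 1) ∣ φ G := by
  induction r with
  | zero => intro G hG; simpa using h0 G (by simpa using hG)
  | succ r ih =>
    intro G hG
    obtain ⟨G₁, G₂, c₁, c₂, hder, hord⟩ := hd G
    obtain ⟨h1, h2⟩ := hord _ hG
    have key : Polynomial.X ^ (r + 1) ∣ Polynomial.derivative (φ G) := by
      rw [hder]
      refine dvd_add (Dvd.dvd.mul_left (ih _ (h1.mono ?_)) _)
        (Dvd.dvd.mul_left (ih _ (h2.mono ?_)) _)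
      all_goals push_cast; linarith
    have h00 := h0 G (hG.mono (by
      have : 0 ≤ ((r + 1 : ℕ) : ℤ) * b := by positivity
      linarith))
    rw [Polynomial.X_pow_dvd_iff] at key ⊢
    rintro (_ | j) hj
    · exact Polynomial.X_dvd_iff.1 h00
    · have := key j (by omega)
      rw [Polynomial.coeff_derivative] at this
      exact (mul_eq_zero.1 this).resolve_right (Nat.cast_add_one_ne_zero j)

end PoissonPlace

/-! ### Weighted normal forms on a Weierstrass surface -/

/-- `Wt d n A`: every monomial `x ^ i * y ^ j` of `A` satisfies `i + d * j ≤ n`. -/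
def Wt {k : Type*} [Field k] (d : ℕ) (n : ℤ) (A : k[X][X]) : Prop :=
  ∀ j i : ℕ, (A.coeff j).coeff i ≠ 0 → (i : ℤ) + d * j ≤ n

namespace Wt

variable {k : Type*} [Field k] {d : ℕ} {m n : ℤ} {A B : k[X][X]}

lemma mono (h : Wt d m A) (hmn : m ≤ n) : Wt d n A := fun j i hc => (h j i hc).trans hmn

lemma zero : Wt d n (0 : k[X][X]) := fun j i hc => by simp at hc

lemma add (hA : Wt d n A) (hB : Wt d n B) : Wt d n (A + B) := by
  intro j i hc
  by_cases h : (A.coeff j).coeff i = 0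
  · refine hB j i fun h' => hc ?_
    simp [h, h']
  · exact hA j i h

lemma neg (hA : Wt d n A) : Wt d n (-A) := fun j i hc => hA j i fun h => hc (by simp [h])

lemma sub (hA : Wt d n A) (hB : Wt d n B) : Wt d n (A - B) := by
  rw [sub_eq_add_neg]; exact hA.add hB.neg

lemma mul (hA : Wt d m A) (hB : Wt d n B) : Wt d (m + n) (A * B) := by
  intro j i hc
  rw [Polynomial.coeff_mul, Polynomial.finsetSum_coeff] at hc
  obtain ⟨⟨j₁, j₂⟩, hj, hc⟩ := Finset.exists_ne_zero_of_sum_ne_zero hc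
  rw [Polynomial.coeff_mul] at hc
  obtain ⟨⟨i₁, i₂⟩, hi, hc⟩ := Finset.exists_ne_zero_of_sum_ne_zero hc
  have h1 := hA j₁ i₁ (left_ne_zero_of_mul hc)
  have h2 := hB j₂ i₂ (right_ne_zero_of_mul hc)
  rw [Finset.HasAntidiagonal.mem_antidiagonal] at hi hj
  subst hi hj
  push_cast
  linarith

lemma C_of_natDegree_le {s : k[X]} {m : ℕ} (hs : s.natDegree ≤ m) :
    Wt d m (Polynomial.C s : k[X][X]) := by
  intro j i hc
  rcases j with _ | j
  · rw [Polynomial.coeff_C_zero] at hc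
    have := (Polynomial.le_natDegree_of_ne_zero hc).trans hs
    simpa using this
  · simp at hc

lemma X : Wt d d (Polynomial.X : k[X][X]) := by
  intro j i hc
  rw [Polynomial.coeff_X] at hc
  split_ifs at hc with h
  · subst h
    rw [Polynomial.coeff_one] at hc
    split_ifs at hc with h
    · subst h; simp
    · exact absurd rfl hc
  · simp at hc

lemma X_pow (l : ℕ) : Wt d (l * d) (Polynomial.X ^ l : k[X][X]) := by
  induction l with
  | zero => simpa using C_of_natDegree_le (d := d) (s := (1 : k[X])) (m := 0) (by simp)
  | succ l ih => rw [pow_succ]; exact (ih.mul X).mono (by push_cast; linarith)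

lemma natDegree_le (hA : Wt d n A) (h0 : A ≠ 0) : (d * A.natDegree : ℤ) ≤ n := by
  have h1 : A.leadingCoeff.leadingCoeff ≠ 0 := by simpa using h0
  have := hA A.natDegree A.leadingCoeff.natDegree h1
  have h2 : (0 : ℤ) ≤ A.leadingCoeff.natDegree := by positivity
  linarith

lemma of_C_mul {π : k[X]} (hπ : 1 ≤ π.natDegree) (h : Wt d n (Polynomial.C π * A)) :
    Wt d (n - 1) A := by
  intro j i hc
  have hA : A.coeff j ≠ 0 := fun h => by simp [h] at hc
  have hp : π ≠ 0 := fun h => by simp [h] at hπ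
  have := h j (π * A.coeff j).natDegree (by
    rw [Polynomial.coeff_C_mul, ← Polynomial.leadingCoeff]
    simpa using ⟨hp, hA⟩)
  rw [Polynomial.natDegree_mul hp hA] at this
  have h2 := Polynomial.le_natDegree_of_ne_zero hc
  push_cast at this
  omega

end Wt

/-- The span of the monomials `x ^ i * y ^ j * z ^ l` of weight `i + 2 * j + 3 * l ≤ n`. -/
def weightSpan (k : Type*) {K : Type*} [Field k] [Field K] [Algebra k K] (x y z : K) (n : ℕ) :
    Submodule k K :=
  Submodule.span k {m | ∃ i j l : ℕ, i + 2 * j + 3 * l ≤ n ∧ m = x ^ i * y ^ j * z ^ l}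

section weightSpan

variable {k K : Type*} [Field k] [Field K] [Algebra k K] {x y z : K} {n : ℕ}

lemma monomial_mem_weightSpan {i j l : ℕ} (h : i + 2 * j + 3 * l ≤ n) :
    x ^ i * y ^ j * z ^ l ∈ weightSpan k x y z n :=
  Submodule.subset_span ⟨i, j, l, h, rfl⟩

lemma weightSpan_mono {m : ℕ} (h : m ≤ n) : weightSpan k x y z m ≤ weightSpan k x y z n :=
  Submodule.span_mono fun _ ⟨i, j, l, hw, e⟩ => ⟨i, j, l, hw.trans h, e⟩

lemma bieval_eq_sum (A : k[X][X]) : bieval x y A =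
    ∑ j ∈ A.support, ∑ i ∈ (A.coeff j).support, (A.coeff j).coeff i • (x ^ i * y ^ j) := by
  rw [bieval, Polynomial.coe_eval₂RingHom, Polynomial.eval₂_eq_sum, Polynomial.sum]
  refine Finset.sum_congr rfl fun j _ => ?_
  simp only [AlgHom.toRingHom_eq_coe, RingHom.coe_coe]
  rw [Polynomial.aeval_eq_sum_range' (Nat.lt_succ_self _), Finset.sum_mul]
  symm
  refine (Finset.sum_subset (fun i hi => ?_) fun i _ hi => ?_).trans
    (Finset.sum_congr rfl fun i _ => (smul_mul_assoc _ _ _).symm)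
  · rw [Finset.mem_range, Nat.lt_succ_iff]
    exact Polynomial.le_natDegree_of_mem_supp i hi
  · rw [Polynomial.notMem_support_iff.1 hi, zero_smul]

lemma bieval_mul_mem_weightSpan {A : k[X][X]} {l : ℕ} (hA : Wt 2 (n - 3 * l) A) :
    bieval x y A * z ^ l ∈ weightSpan k x y z n := by
  rw [bieval_eq_sum, Finset.sum_mul]
  refine Submodule.sum_mem _ fun j _ => ?_
  rw [Finset.sum_mul]
  refine Submodule.sum_mem _ fun i hi => ?_
  rw [smul_mul_assoc]
  have := hA j i (Polynomial.mem_support_iff.1 hi)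
  exact Submodule.smul_mem _ _ (monomial_mem_weightSpan (by push_cast at this; omega))

lemma bieval_mul_mem_weightSpan' {A : k[X][X]} {l : ℕ} (hA : Wt 3 (n - 2 * l) A) :
    bieval x z A * y ^ l ∈ weightSpan k x y z n := by
  rw [bieval_eq_sum, Finset.sum_mul]
  refine Submodule.sum_mem _ fun j _ => ?_
  rw [Finset.sum_mul]
  refine Submodule.sum_mem _ fun i hi => ?_
  rw [smul_mul_assoc]
  have := hA j i (Polynomial.mem_support_iff.1 hi)
  refine Submodule.smul_mem _ _ ?_
  rw [show x ^ i * z ^ j * y ^ l = x ^ i * y ^ l * z ^ j by ring]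
  exact monomial_mem_weightSpan (by push_cast at this; omega)

lemma weightSpan_induction {Q : ℤ → K → Prop} (h1 : Q 0 1)
    (hx : ∀ m f, Q m f → Q (m + 1) (x * f)) (hy : ∀ m f, Q m f → Q (m + 2) (y * f))
    (hz : ∀ m f, Q m f → Q (m + 3) (z * f)) (hmono : ∀ m m' f, m ≤ m' → Q m f → Q m' f)
    (h0 : ∀ m, Q m 0) (hadd : ∀ m f g, Q m f → Q m g → Q m (f + g))
    (hsmul : ∀ m (c : k) f, Q m f → Q m (c • f)) {f : K} (hf : f ∈ weightSpan k x y z n) :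
    Q n f := by
  induction hf using Submodule.span_induction with
  | zero => exact h0 _
  | add f g _ _ hf hg => exact hadd _ _ _ hf hg
  | smul c f _ hf => exact hsmul _ _ _ hf
  | mem f hf =>
    obtain ⟨i, j, l, hw, rfl⟩ := hf
    refine hmono ((i + 2 * j + 3 * l : ℕ) : ℤ) n _ (by exact_mod_cast hw) ?_
    clear hw
    have hzl : ∀ l : ℕ, Q (3 * l : ℕ) (z ^ l) := fun l => by
      induction l with
      | zero => simpa using h1
      | succ l ih => rw [pow_succ']; simpa [mul_add] using hz _ _ ih
    have hyl : ∀ j : ℕ, Q (2 * j + 3 * l : ℕ) (y ^ j * z ^ l) := fun j => by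
      induction j with
      | zero => simpa using hzl l
      | succ j ih =>
        rw [pow_succ', mul_assoc]
        have := hy _ _ ih
        refine hmono _ _ _ ?_ this
        push_cast; linarith
    induction i with
    | zero => simpa using hyl j
    | succ i ih =>
      rw [pow_succ', mul_assoc, mul_assoc]
      have := hx _ _ ih
      rw [mul_assoc] at this
      refine hmono _ _ _ ?_ this
      push_cast; linarith

variable {s : k[X]}

lemma exists_normalForm_z (hs : s.natDegree ≤ 6) (he : y ^ 3 + z ^ 2 = Polynomial.aeval x s)
    {f : K} (hf : f ∈ weightSpan k x y z n) :
    ∃ A B : k[X][X], Wt 2 n A ∧ Wt 2 (n - 3) B ∧ f = bieval x y A + bieval x y B * z := by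
  have hCX : Wt 2 1 (Polynomial.C Polynomial.X : k[X][X]) :=
    Wt.C_of_natDegree_le (m := 1) Polynomial.natDegree_X_le
  refine weightSpan_induction (Q := fun m f => ∃ A B : k[X][X], Wt 2 m A ∧ Wt 2 (m - 3) B ∧
    f = bieval x y A + bieval x y B * z) ?_ ?_ ?_ ?_ ?_ ?_ ?_ ?_ hf
  · exact ⟨1, 0, by simpa using Wt.X_pow (k := k) (d := 2) 0, Wt.zero, by simp⟩
  · rintro m f ⟨A, B, hA, hB, rfl⟩
    refine ⟨Polynomial.C Polynomial.X * A, Polynomial.C Polynomial.X * B,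
      (hCX.mul hA).mono (by linarith), (hCX.mul hB).mono (by linarith), ?_⟩
    simp
    ring
  · rintro m f ⟨A, B, hA, hB, rfl⟩
    refine ⟨Polynomial.X * A, Polynomial.X * B,
      (Wt.X.mul hA).mono (by push_cast; linarith), (Wt.X.mul hB).mono (by push_cast; linarith), ?_⟩
    simp
    ring
  · rintro m f ⟨A, B, hA, hB, rfl⟩
    refine ⟨B * (Polynomial.C s - Polynomial.X ^ 3), A, ?_, hA.mono (by linarith), ?_⟩
    · have h6 : Wt 2 6 (Polynomial.C s - Polynomial.X ^ 3) :=
        (Wt.C_of_natDegree_le (m := 6) hs).sub ((Wt.X_pow 3).mono (by norm_num))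
      exact (hB.mul h6).mono (by linarith)
    · simp only [map_mul, map_sub, map_pow, bieval_C, bieval_X, ← he]
      ring
  · rintro m m' f hm ⟨A, B, hA, hB, rfl⟩
    exact ⟨A, B, hA.mono hm, hB.mono (by linarith), rfl⟩
  · exact fun m => ⟨0, 0, Wt.zero, Wt.zero, by simp⟩
  · rintro m _ _ ⟨A, B, hA, hB, rfl⟩ ⟨A', B', hA', hB', rfl⟩
    exact ⟨A + A', B + B', hA.add hA', hB.add hB', by simp; ring⟩
  · rintro m c _ ⟨A, B, hA, hB, rfl⟩
    have hC : Wt 2 0 (Polynomial.C (Polynomial.C c) : k[X][X]) :=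
      Wt.C_of_natDegree_le (m := 0) (by simp)
    refine ⟨Polynomial.C (Polynomial.C c) * A, Polynomial.C (Polynomial.C c) * B,
      (hC.mul hA).mono (by linarith), (hC.mul hB).mono (by linarith), ?_⟩
    simp [Algebra.smul_def]
    ring

lemma exists_normalForm_y (hs : s.natDegree ≤ 6) (he : y ^ 3 + z ^ 2 = Polynomial.aeval x s)
    {f : K} (hf : f ∈ weightSpan k x y z n) :
    ∃ A B C : k[X][X], Wt 3 n A ∧ Wt 3 (n - 2) B ∧ Wt 3 (n - 4) C ∧
      f = bieval x z A + bieval x z B * y + bieval x z C * y ^ 2 := by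
  have hCX : Wt 3 1 (Polynomial.C Polynomial.X : k[X][X]) :=
    Wt.C_of_natDegree_le (m := 1) Polynomial.natDegree_X_le
  refine weightSpan_induction (Q := fun m f => ∃ A B C : k[X][X], Wt 3 m A ∧ Wt 3 (m - 2) B ∧
    Wt 3 (m - 4) C ∧ f = bieval x z A + bieval x z B * y + bieval x z C * y ^ 2)
    ?_ ?_ ?_ ?_ ?_ ?_ ?_ ?_ hf
  · exact ⟨1, 0, 0, by simpa using Wt.X_pow (k := k) (d := 3) 0, Wt.zero, Wt.zero, by simp⟩
  · rintro m f ⟨A, B, C, hA, hB, hC, rfl⟩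
    refine ⟨Polynomial.C Polynomial.X * A, Polynomial.C Polynomial.X * B,
      Polynomial.C Polynomial.X * C, (hCX.mul hA).mono (by linarith),
      (hCX.mul hB).mono (by linarith), (hCX.mul hC).mono (by linarith), ?_⟩
    simp
    ring
  · rintro m f ⟨A, B, C, hA, hB, hC, rfl⟩
    refine ⟨C * (Polynomial.C s - Polynomial.X ^ 2), A, B, ?_, hA.mono (by linarith),
      hB.mono (by linarith), ?_⟩
    · have h6 : Wt 3 6 (Polynomial.C s - Polynomial.X ^ 2) :=
        (Wt.C_of_natDegree_le (m := 6) hs).sub ((Wt.X_pow 2).mono (by norm_num))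
      exact (hC.mul h6).mono (by linarith)
    · simp only [map_mul, map_sub, map_pow, bieval_C, bieval_X, ← he]
      ring
  · rintro m f ⟨A, B, C, hA, hB, hC, rfl⟩
    refine ⟨Polynomial.X * A, Polynomial.X * B, Polynomial.X * C,
      (Wt.X.mul hA).mono (by push_cast; linarith), (Wt.X.mul hB).mono (by push_cast; linarith),
      (Wt.X.mul hC).mono (by push_cast; linarith), ?_⟩
    simp
    ring
  · rintro m m' f hm ⟨A, B, C, hA, hB, hC, rfl⟩
    exact ⟨A, B, C, hA.mono hm, hB.mono (by linarith), hC.mono (by linarith), rfl⟩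
  · exact fun m => ⟨0, 0, 0, Wt.zero, Wt.zero, Wt.zero, by simp⟩
  · rintro m _ _ ⟨A, B, C, hA, hB, hC, rfl⟩ ⟨A', B', C', hA', hB', hC', rfl⟩
    exact ⟨A + A', B + B', C + C', hA.add hA', hB.add hB', hC.add hC', by simp; ring⟩
  · rintro m c _ ⟨A, B, C, hA, hB, hC, rfl⟩
    have hc : Wt 3 0 (Polynomial.C (Polynomial.C c) : k[X][X]) :=
      Wt.C_of_natDegree_le (m := 0) (by simp)
    refine ⟨Polynomial.C (Polynomial.C c) * A, Polynomial.C (Polynomial.C c) * B,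
      Polynomial.C (Polynomial.C c) * C, (hc.mul hA).mono (by linarith),
      (hc.mul hB).mono (by linarith), (hc.mul hC).mono (by linarith), ?_⟩
    simp [Algebra.smul_def]
    ring

end weightSpan

/-! ### Norm forms over a field -/

section normForms

variable {κ : Type*} [Field κ]

lemma eq_zero_of_quadratic_norm {a b : κ[X]} (c : κ)
    (h : a ^ 2 = b ^ 2 * (Polynomial.C c - Polynomial.X ^ 3)) : a = 0 ∧ b = 0 := by
  have hdeg : (Polynomial.C c - Polynomial.X ^ 3).natDegree = 3 := by compute_degree!
  have he : (Polynomial.C c - Polynomial.X ^ 3 : κ[X]) ≠ 0 := fun h0 => by simp [h0] at hdeg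
  by_cases hb : b = 0
  · subst hb; simpa using h
  · have := congrArg Polynomial.natDegree h
    rw [Polynomial.natDegree_mul (pow_ne_zero _ hb) he, hdeg, Polynomial.natDegree_pow,
      Polynomial.natDegree_pow] at this
    omega

lemma eq_zero_of_comp_add {a b : κ[X]}
    (h : a.comp (-Polynomial.X ^ 2) + b.comp (-Polynomial.X ^ 2) * Polynomial.X ^ 3 = 0) :
    a = 0 ∧ b = 0 := by
  have h2 : (-Polynomial.X ^ 2 : κ[X]).natDegree = 2 := by simp
  have hz (p : κ[X]) : p.comp (-Polynomial.X ^ 2) = 0 → p = 0 := fun hp => by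
    rcases Polynomial.comp_eq_zero_iff.1 hp with h | ⟨_, h⟩
    · exact h
    · rw [h] at h2; simp at h2
  by_cases hb : b = 0
  · subst hb
    exact ⟨hz a (by simpa using h), rfl⟩
  · have := congrArg Polynomial.natDegree (eq_neg_of_add_eq_zero_left h)
    rw [Polynomial.natDegree_neg, Polynomial.natDegree_mul (fun h => hb (hz b h))
      (pow_ne_zero _ Polynomial.X_ne_zero), Polynomial.natDegree_comp, Polynomial.natDegree_comp,
      h2, Polynomial.natDegree_X_pow] at this
    omega

lemma eq_zero_of_cubic_norm {a b c e : κ[X]} (he : e.natDegree = 2)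
    (h : a ^ 3 + b ^ 3 * e + c ^ 3 * e ^ 2 - 3 * (a * b * c * e) = 0) :
    a = 0 ∧ b = 0 ∧ c = 0 := by
  have he0 : e ≠ 0 := fun h0 => by simp [h0] at he
  have hd (p : κ[X]) (i : ℕ) : (p ^ 3 * e ^ i).natDegree ≤ 3 * p.natDegree + 2 * i := by
    refine Polynomial.natDegree_mul_le.trans ?_
    rw [Polynomial.natDegree_pow, Polynomial.natDegree_pow, he]
    omega
  have hl (p : κ[X]) (hp : p ≠ 0) (i : ℕ) :
      (p ^ 3 * e ^ i).coeff (3 * p.natDegree + 2 * i) ≠ 0 := by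
    have h1 : (p ^ 3 * e ^ i).natDegree = 3 * p.natDegree + 2 * i := by
      rw [Polynomial.natDegree_mul (pow_ne_zero _ hp) (pow_ne_zero _ he0),
        Polynomial.natDegree_pow, Polynomial.natDegree_pow, he]
      omega
    rw [← h1]
    exact Polynomial.leadingCoeff_ne_zero.2 (mul_ne_zero (pow_ne_zero _ hp) (pow_ne_zero _ he0))
  have hz (p : κ[X]) (i m : ℕ) (hm : p ≠ 0 → 3 * p.natDegree + 2 * i < m) :
      (p ^ 3 * e ^ i).coeff m = 0 := by
    by_cases hp : p = 0
    · simp [hp]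
    · exact Polynomial.coeff_eq_zero_of_natDegree_lt ((hd p i).trans_lt (hm hp))
  have hm (m : ℕ) (hm : a ≠ 0 → b ≠ 0 → c ≠ 0 → a.natDegree + b.natDegree + c.natDegree + 2 < m) :
      (3 * (a * b * c * e)).coeff m = 0 := by
    by_cases h0 : a * b * c * e = 0
    · simp [h0]
    · have hab := left_ne_zero_of_mul h0
      have hab' := left_ne_zero_of_mul hab
      refine Polynomial.coeff_eq_zero_of_natDegree_lt (lt_of_le_of_lt ?_
        (hm (left_ne_zero_of_mul hab') (right_ne_zero_of_mul hab') (right_ne_zero_of_mul hab)))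
      rw [← map_ofNat Polynomial.C 3]
      refine (Polynomial.natDegree_C_mul_le _ _).trans ?_
      rw [Polynomial.natDegree_mul hab he0, Polynomial.natDegree_mul hab'
        (right_ne_zero_of_mul hab), Polynomial.natDegree_mul (left_ne_zero_of_mul hab')
        (right_ne_zero_of_mul hab'), he]
  have hcoef (m : ℕ) : (a ^ 3 * e ^ 0).coeff m + (b ^ 3 * e ^ 1).coeff m +
      (c ^ 3 * e ^ 2).coeff m - (3 * (a * b * c * e)).coeff m = 0 := by
    have := congrArg (fun q => Polynomial.coeff q m) h
    simpa using this
  have ca : a ≠ 0 → ¬((b ≠ 0 → 3 * b.natDegree + 2 < 3 * a.natDegree) ∧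
      (c ≠ 0 → 3 * c.natDegree + 4 < 3 * a.natDegree)) := by
    rintro ha ⟨hb, hc⟩
    have := hcoef (3 * a.natDegree + 2 * 0)
    rw [hz b 1 _ (fun h => by have := hb h; omega), hz c 2 _ (fun h => by have := hc h; omega),
      hm _ (fun _ h1 h2 => by have := hb h1; have := hc h2; omega)] at this
    exact hl a ha 0 (by simpa using this)
  have cb : b ≠ 0 → ¬((a ≠ 0 → 3 * a.natDegree < 3 * b.natDegree + 2) ∧
      (c ≠ 0 → 3 * c.natDegree + 4 < 3 * b.natDegree + 2)) := by
    rintro hb ⟨ha, hc⟩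
    have := hcoef (3 * b.natDegree + 2 * 1)
    rw [hz a 0 _ (by simpa using ha), hz c 2 _ (by simpa using hc),
      hm _ (fun h1 _ h2 => by have := ha h1; have := hc h2; omega)] at this
    exact hl b hb 1 (by simpa using this)
  have cc : c ≠ 0 → ¬((a ≠ 0 → 3 * a.natDegree < 3 * c.natDegree + 4) ∧
      (b ≠ 0 → 3 * b.natDegree + 2 < 3 * c.natDegree + 4)) := by
    rintro hc ⟨ha, hb⟩
    have := hcoef (3 * c.natDegree + 2 * 2)
    rw [hz a 0 _ (by simpa using ha), hz b 1 _ (by simpa using hb),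
      hm _ (fun h1 h2 _ => by have := ha h1; have := hb h2; omega)] at this
    exact hl c hc 2 (by simpa using this)
  by_cases ha : a = 0 <;> by_cases hb : b = 0 <;> by_cases hc : c = 0 <;>
    simp only [ha, hb, hc, ne_eq, not_true_eq_false, not_false_eq_true, false_imp_iff,
      true_imp_iff, and_true, true_and] at ca cb cc ⊢ <;> omega

end normForms

/-! ### Charts of the Weierstrass fibration -/

/-- Affine coordinates `y ^ 3 + z ^ 2 = s x` that are regular along the place, in which the
bracket is the Hamiltonian one. -/
structure IsChart {k K : Type*} [Field k] [Field K] [Algebra k K] (p : PoissonPlace k K)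
    (s : k[X]) (x y z : K) : Prop where
  eqn : y ^ 3 + z ^ 2 = Polynomial.aeval x s
  natDegree_le : s.natDegree ≤ 6
  separable : s.Separable
  bracket_xy : p.bracket x y = 2 * z
  bracket_zx : p.bracket z x = 3 * y ^ 2
  bracket_yz : p.bracket y z = -Polynomial.aeval x (Polynomial.derivative s)
  ord_x : VanishesTo p.v 0 x
  ord_y : VanishesTo p.v 0 y
  ord_z : VanishesTo p.v 0 z

section chart

variable {k K : Type*} [Field k] [Field K] [Algebra k K]

lemma VanishesTo.le_zero_of_unit {v : Valuation K ℤᵐ⁰} {r : ℤ} {f : K} (h : VanishesTo v r f)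
    (hf : v f = 1) : r ≤ 0 := by
  by_contra hr
  exact VanishesTo.not_one_of_unit hf (h.mono (by omega))

lemma PoissonPlace.valuation_ofNat [CharZero k] (p : PoissonPlace k K) (n : ℕ) [n.AtLeastTwo] :
    p.v (OfNat.ofNat n : K) = 1 := by
  rw [← map_ofNat (algebraMap k K) n]
  exact p.map_const _ (OfNat.ofNat_ne_zero n)

lemma C_dvd_iff_map_mk_eq_zero {π : k[X]} {A : k[X][X]} :
    Polynomial.C π ∣ A ↔ A.map (AdjoinRoot.mk π) = 0 := by
  rw [Polynomial.C_dvd_iff_dvd_coeff, Polynomial.ext_iff]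
  simp [AdjoinRoot.mk_eq_zero]

variable {x y z : K} {π : k[X]} {m : ℕ}

lemma exists_factor_of_normalForm_z (hπ : 1 ≤ π.natDegree) {A B : k[X][X]}
    (hA : Wt 2 (m + 1 : ℕ) A) (hB : Wt 2 ((m + 1 : ℕ) - 3) B)
    (dA : Polynomial.C π ∣ A) (dB : Polynomial.C π ∣ B) :
    ∃ f' ∈ weightSpan k x y z m,
      bieval x y A + bieval x y B * z = Polynomial.aeval x π * f' := by
  obtain ⟨A, rfl⟩ := dA
  obtain ⟨B, rfl⟩ := dB
  refine ⟨bieval x y A * z ^ 0 + bieval x y B * z ^ 1, Submodule.add_mem _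
    (bieval_mul_mem_weightSpan ((hA.of_C_mul hπ).mono (by push_cast; linarith)))
    (bieval_mul_mem_weightSpan ((hB.of_C_mul hπ).mono (by push_cast; linarith))), ?_⟩
  simp only [map_mul, bieval_C]
  ring

lemma exists_factor_of_normalForm_y (hπ : 1 ≤ π.natDegree) {A B C : k[X][X]}
    (hA : Wt 3 (m + 1 : ℕ) A) (hB : Wt 3 ((m + 1 : ℕ) - 2) B) (hC : Wt 3 ((m + 1 : ℕ) - 4) C)
    (dA : Polynomial.C π ∣ A) (dB : Polynomial.C π ∣ B) (dC : Polynomial.C π ∣ C) :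
    ∃ f' ∈ weightSpan k x y z m,
      bieval x z A + bieval x z B * y + bieval x z C * y ^ 2 = Polynomial.aeval x π * f' := by
  obtain ⟨A, rfl⟩ := dA
  obtain ⟨B, rfl⟩ := dB
  obtain ⟨C, rfl⟩ := dC
  refine ⟨bieval x z A * y ^ 0 + bieval x z B * y ^ 1 + bieval x z C * y ^ 2,
    Submodule.add_mem _ (Submodule.add_mem _
    (bieval_mul_mem_weightSpan' ((hA.of_C_mul hπ).mono (by push_cast; linarith)))
    (bieval_mul_mem_weightSpan' ((hB.of_C_mul hπ).mono (by push_cast; linarith))))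
    (bieval_mul_mem_weightSpan' ((hC.of_C_mul hπ).mono (by push_cast; linarith))), ?_⟩
  simp only [map_mul, bieval_C]
  ring

namespace IsChart

variable {p : PoissonPlace k K} {s : k[X]} [CharZero k]

lemma exists_factor_of_unit_z (h : IsChart p s x y z) (hirr : Irreducible π)
    (hπ : VanishesTo p.v 1 (Polynomial.aeval x π)) (hz : p.v z = 1) {f : K}
    (hf : f ∈ weightSpan k x y z (m + 1)) (hord : VanishesTo p.v ((m + 1 : ℕ) * p.a + 1) f) :
    ∃ f' ∈ weightSpan k x y z m, f = Polynomial.aeval x π * f' := by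
  have hu : p.v (p.bracket x y) = 1 := by rw [h.bracket_xy, map_mul, hz, p.valuation_ofNat, one_mul]
  have ha : 0 ≤ p.a := by
    have := (PoissonPlace.ord_bracket_left hirr h.ord_x hπ h.ord_y).le_zero_of_unit hu
    omega
  obtain ⟨A, B, hA, hB, rfl⟩ := exists_normalForm_z h.natDegree_le h.eqn hf
  have hP : Wt 2 (2 * (m + 1 : ℕ))
      (A ^ 2 - B ^ 2 * (Polynomial.C s - Polynomial.X ^ 3)) := by
    refine Wt.sub ?_ ?_
    · rw [pow_two]; exact (hA.mul hA).mono (by linarith)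
    · rw [pow_two]
      exact ((hB.mul hB).mul ((Wt.C_of_natDegree_le h.natDegree_le).sub (Wt.X_pow 3))).mono
        (by push_cast; linarith)
  have hdeg : (A ^ 2 - B ^ 2 * (Polynomial.C s - Polynomial.X ^ 3)).natDegree ≤ m + 1 := by
    rcases eq_or_ne (A ^ 2 - B ^ 2 * (Polynomial.C s - Polynomial.X ^ 3)) 0 with h0 | h0
    · simp [h0]
    · have := hP.natDegree_le h0
      push_cast at this
      omega
  have hdvd := PoissonPlace.C_dvd_of_ord hirr h.ord_x hπ h.ord_y hu ha _ _ hdeg (by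
    have e : bieval x y (A ^ 2 - B ^ 2 * (Polynomial.C s - Polynomial.X ^ 3)) =
        (bieval x y A - bieval x y B * z) * (bieval x y A + bieval x y B * z) := by
      simp only [map_sub, map_mul, map_pow, bieval_C, bieval_X]
      linear_combination (bieval x y B) ^ 2 * h.eqn
    rw [e]
    exact ((PoissonPlace.ord_bieval h.ord_x h.ord_y A).sub
      ((PoissonPlace.ord_bieval h.ord_x h.ord_y B).mul_left h.ord_z)).mul_left hord)
  have : Fact (Irreducible π) := ⟨hirr⟩
  rw [C_dvd_iff_map_mk_eq_zero] at hdvd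
  obtain ⟨a0, b0⟩ := eq_zero_of_quadratic_norm (a := A.map (AdjoinRoot.mk π))
    (b := B.map (AdjoinRoot.mk π)) (AdjoinRoot.mk π s) (by simpa [sub_eq_zero] using hdvd)
  exact exists_factor_of_normalForm_z hirr.natDegree_pos hA hB
    (C_dvd_iff_map_mk_eq_zero.2 a0) (C_dvd_iff_map_mk_eq_zero.2 b0)

lemma exists_factor_of_unit_y (h : IsChart p s x y z) (hirr : Irreducible π)
    (hπ : VanishesTo p.v 1 (Polynomial.aeval x π)) (hy : p.v y = 1) {f : K}
    (hf : f ∈ weightSpan k x y z (m + 1)) (hord : VanishesTo p.v ((m + 1 : ℕ) * p.a + 1) f) :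
    ∃ f' ∈ weightSpan k x y z m, f = Polynomial.aeval x π * f' := by
  have hu : p.v (p.bracket x z) = 1 := by
    rw [p.anti, h.bracket_zx, Valuation.map_neg, map_mul, map_pow, hy, p.valuation_ofNat]; simp
  have ha : 0 ≤ p.a := by
    have := (PoissonPlace.ord_bracket_left hirr h.ord_x hπ h.ord_z).le_zero_of_unit hu
    omega
  obtain ⟨A, B, C, hA, hB, hC, rfl⟩ := exists_normalForm_y h.natDegree_le h.eqn hf
  set e : k[X][X] := Polynomial.C s - Polynomial.X ^ 2 with he
  have hew : Wt 3 6 e := (Wt.C_of_natDegree_le h.natDegree_le).sub (Wt.X_pow 2)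
  have hP : Wt 3 (3 * (m + 1 : ℕ))
      (A ^ 3 + B ^ 3 * e + C ^ 3 * e ^ 2 - (A * B * C * e + A * B * C * e + A * B * C * e)) := by
    have hABC := (((hA.mul hB).mul hC).mul hew)
    refine Wt.sub (Wt.add (Wt.add ?_ ?_) ?_)
      (((hABC.add hABC).add hABC).mono (by push_cast; linarith))
    · rw [pow_three]; exact (hA.mul (hA.mul hA)).mono (by linarith)
    · rw [pow_three]; exact ((hB.mul (hB.mul hB)).mul hew).mono (by push_cast; linarith)
    · rw [pow_three, pow_two]
      exact ((hC.mul (hC.mul hC)).mul (hew.mul hew)).mono (by push_cast; linarith)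
  rw [show A ^ 3 + B ^ 3 * e + C ^ 3 * e ^ 2 - (A * B * C * e + A * B * C * e + A * B * C * e) =
    A ^ 3 + B ^ 3 * e + C ^ 3 * e ^ 2 - 3 * (A * B * C * e) by ring] at hP
  have hdeg : (A ^ 3 + B ^ 3 * e + C ^ 3 * e ^ 2 - 3 * (A * B * C * e)).natDegree ≤ m + 1 := by
    rcases eq_or_ne (A ^ 3 + B ^ 3 * e + C ^ 3 * e ^ 2 - 3 * (A * B * C * e)) 0 with h0 | h0
    · simp [h0]
    · have := hP.natDegree_le h0
      push_cast at this
      omega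
  have hdvd := PoissonPlace.C_dvd_of_ord hirr h.ord_x hπ h.ord_z hu ha _ _ hdeg (by
    have ee : bieval x z e = y ^ 3 := by
      simp only [he, map_sub, map_pow, bieval_C, bieval_X]
      linear_combination -h.eqn
    have hr (Q : k[X][X]) := PoissonPlace.ord_bieval h.ord_x h.ord_z Q
    have e : bieval x z (A ^ 3 + B ^ 3 * e + C ^ 3 * e ^ 2 - 3 * (A * B * C * e)) =
        (bieval x z (A ^ 2 - B * C * e) + bieval x z (C ^ 2 * e - A * B) * y +
          bieval x z (B ^ 2 - A * C) * y ^ 2) *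
        (bieval x z A + bieval x z B * y + bieval x z C * y ^ 2) := by
      simp only [map_sub, map_add, map_mul, map_pow, map_ofNat, ee]
      ring
    rw [e]
    exact (((hr _).add ((hr _).mul_left h.ord_y)).add
      ((hr _).mul_left (h.ord_y.pow 2))).mul_left hord)
  have : Fact (Irreducible π) := ⟨hirr⟩
  rw [C_dvd_iff_map_mk_eq_zero] at hdvd
  obtain ⟨a0, b0, c0⟩ := eq_zero_of_cubic_norm (a := A.map (AdjoinRoot.mk π))
    (b := B.map (AdjoinRoot.mk π)) (c := C.map (AdjoinRoot.mk π))
    (e := e.map (AdjoinRoot.mk π)) (by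
      rw [he]; simp only [Polynomial.map_sub, Polynomial.map_C, Polynomial.map_pow,
        Polynomial.map_X]
      compute_degree!) (by simpa using hdvd)
  exact exists_factor_of_normalForm_y hirr.natDegree_pos hA hB hC
    (C_dvd_iff_map_mk_eq_zero.2 a0) (C_dvd_iff_map_mk_eq_zero.2 b0)
    (C_dvd_iff_map_mk_eq_zero.2 c0)

end IsChart

end chart

section trivariate

variable {k : Type*} [Field k]

/-- A polynomial in two variables, seen in the first two of three variables. -/
def triLift : k[X][X] →+* MvPolynomial (Fin 3) k :=
  Polynomial.eval₂RingHom (Polynomial.aeval (X 0) : k[X] →ₐ[k] MvPolynomial (Fin 3) k).toRingHom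
    (X 1)

lemma aeval_triLift {S : Type*} [CommRing S] [Algebra k S] (w : Fin 3 → S) (A : k[X][X]) :
    aeval w (triLift A) = A.eval₂ (Polynomial.aeval (w 0) : k[X] →ₐ[k] S).toRingHom (w 1) := by
  induction A using Polynomial.induction_on' with
  | add p q hp hq => simp only [map_add, hp, hq, Polynomial.eval₂_add]
  | monomial n c =>
    simp only [triLift, Polynomial.coe_eval₂RingHom, Polynomial.eval₂_monomial, map_mul, map_pow,
      aeval_X, AlgHom.toRingHom_eq_coe, RingHom.coe_coe]
    rw [← Polynomial.aeval_algHom_apply (aeval w : MvPolynomial (Fin 3) k →ₐ[k] S), aeval_X]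

/-- The Hamiltonian derivation of `z` for `y ^ 3 + z ^ 2 = s x`. -/
def hamiltonianZ (s : k[X]) : Derivation k (MvPolynomial (Fin 3) k) (MvPolynomial (Fin 3) k) :=
  mkDerivation k ![3 * X 1 ^ 2, Polynomial.aeval (X 0) (Polynomial.derivative s), 0]

/-- The opposite of the Hamiltonian derivation of `y` for `y ^ 3 + z ^ 2 = s x`. -/
def hamiltonianY (s : k[X]) : Derivation k (MvPolynomial (Fin 3) k) (MvPolynomial (Fin 3) k) :=
  mkDerivation k ![2 * X 2, 0, Polynomial.aeval (X 0) (Polynomial.derivative s)]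

/-- The Hamiltonian derivations of `y` and `z` restrict to multiples of the derivative along the
cuspidal parametrization of the fibre over a root of `s`. -/
lemma derivative_cusp {κ : Type*} [Field κ] [Algebra k κ] (s : k[X]) (ρ : κ)
    (w : Fin 3 → κ[X]) (hw : w = ![Polynomial.C ρ, -Polynomial.X ^ 2, Polynomial.X ^ 3])
    (G : MvPolynomial (Fin 3) k) :
    Polynomial.C (Polynomial.aeval ρ (Polynomial.derivative s)) *
        Polynomial.derivative (aeval w G) =
      (-2 * Polynomial.X) * aeval w (hamiltonianZ s G) +
      (3 * Polynomial.X ^ 2) * aeval w (hamiltonianY s G) := by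
  have hs : aeval w (Polynomial.aeval (X 0) (Polynomial.derivative s) : MvPolynomial (Fin 3) k) =
      Polynomial.C (Polynomial.aeval ρ (Polynomial.derivative s)) := by
    rw [← Polynomial.aeval_algHom_apply (aeval w : MvPolynomial (Fin 3) k →ₐ[k] κ[X]), aeval_X, hw]
    exact Polynomial.aeval_algHom_apply (Polynomial.CAlgHom : κ →ₐ[k] κ[X]) ρ _
  have w0 : w 0 = Polynomial.C ρ := by rw [hw]; rfl
  have w1 : w 1 = -Polynomial.X ^ 2 := by rw [hw]; rfl
  have w2 : w 2 = Polynomial.X ^ 3 := by rw [hw]; rfl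
  induction G using MvPolynomial.induction_on with
  | C a =>
    rw [← MvPolynomial.algebraMap_eq, Derivation.map_algebraMap, Derivation.map_algebraMap]
    simp [Polynomial.algebraMap_apply]
  | add f g hf hg => simp only [map_add, mul_add, hf, hg]; ring
  | mul_X f i hf =>
    simp only [map_mul, Derivation.leibniz, smul_eq_mul, map_add,
      Polynomial.derivative_mul, aeval_X]
    fin_cases i
    · simp [w0, w1, w2, hamiltonianZ, hamiltonianY] at hf ⊢
      linear_combination (Polynomial.C ρ) * hf
    · simp [w1, hs, hamiltonianZ, hamiltonianY] at hf ⊢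
      linear_combination (-Polynomial.X ^ 2) * hf
    · simp [w2, hs, hamiltonianZ, hamiltonianY] at hf ⊢
      rw [map_ofNat Polynomial.C 2]
      linear_combination (Polynomial.X ^ 3) * hf

end trivariate

namespace IsChart

variable {k K : Type*} [Field k] [Field K] [Algebra k K]
variable {p : PoissonPlace k K} {s : k[X]} {x y z : K} {π : k[X]} {m : ℕ}

lemma derivation_aeval_eq (D : Derivation k K K) (w : Fin 3 → K)
    (E : Derivation k (MvPolynomial (Fin 3) k) (MvPolynomial (Fin 3) k))
    (h : ∀ i, D (w i) = aeval w (E (X i))) (G : MvPolynomial (Fin 3) k) :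
    D (aeval w G) = aeval w (E G) := by
  induction G using MvPolynomial.induction_on with
  | C a =>
    rw [← MvPolynomial.algebraMap_eq, Derivation.map_algebraMap, AlgHom.commutes,
      Derivation.map_algebraMap, map_zero]
  | add f g hf hg => simp only [map_add, hf, hg]
  | mul_X f i hf =>
    simp only [map_mul, Derivation.leibniz, smul_eq_mul, map_add, aeval_X, hf, h]

lemma exists_const_residue {κ : Type*} [Field κ] [Algebra k κ] (ρ : κ) (hx : VanishesTo p.v 0 x)
    (hy : VanishesTo p.v 1 y) (hz : VanishesTo p.v 1 z)
    (w : Fin 3 → κ[X]) (hw : w = ![Polynomial.C ρ, -Polynomial.X ^ 2, Polynomial.X ^ 3])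
    (G : MvPolynomial (Fin 3) k) : ∃ c : k[X],
      VanishesTo p.v 1 (aeval ![x, y, z] G - Polynomial.aeval x c) ∧
      (aeval w G).coeff 0 = Polynomial.aeval ρ c := by
  have w0 : w 0 = Polynomial.C ρ := by rw [hw]; rfl
  have w1 : w 1 = -Polynomial.X ^ 2 := by rw [hw]; rfl
  have w2 : w 2 = Polynomial.X ^ 3 := by rw [hw]; rfl
  induction G using MvPolynomial.induction_on with
  | C a =>
    refine ⟨Polynomial.C a, ?_, ?_⟩
    · simpa using VanishesTo.zero
    · simp [Polynomial.algebraMap_apply]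
  | add f g hf hg =>
    obtain ⟨c, hc, hc'⟩ := hf
    obtain ⟨d, hd, hd'⟩ := hg
    refine ⟨c + d, ?_, by simp [hc', hd']⟩
    convert hc.add hd using 1
    simp only [map_add]; ring
  | mul_X f i hf =>
    obtain ⟨c, hc, hc'⟩ := hf
    have hf0 : VanishesTo p.v 0 (aeval ![x, y, z] f) := by
      have := (hc.mono zero_le_one).add (PoissonPlace.ord_aeval hx c)
      simpa using this
    fin_cases i
    · refine ⟨c * Polynomial.X, ?_, by simp [hc', w0]⟩
      convert hx.mul_left hc using 1
      simp; ring
    · refine ⟨0, ?_, by simp [w1, Polynomial.mul_coeff_zero]⟩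
      simpa using hf0.mul_left hy
    · refine ⟨0, ?_, by simp [w2, Polynomial.mul_coeff_zero]⟩
      simpa using hf0.mul_left hz

variable [CharZero k]

lemma exists_factor_of_cusp (h : IsChart p s x y z) (hirr : Irreducible π)
    (hπ : VanishesTo p.v 1 (Polynomial.aeval x π)) (hy : VanishesTo p.v 1 y)
    (hz : VanishesTo p.v 1 z) {f : K}
    (hf : f ∈ weightSpan k x y z (m + 1)) (hord : VanishesTo p.v ((m + 1 : ℕ) * p.a + 1) f) :
    ∃ f' ∈ weightSpan k x y z m, f = Polynomial.aeval x π * f' := by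
  have : Fact (Irreducible π) := ⟨hirr⟩
  have : CharZero (AdjoinRoot π) :=
    charZero_of_injective_algebraMap (algebraMap k (AdjoinRoot π)).injective
  have hs : VanishesTo p.v 1 (Polynomial.aeval x s) := by
    rw [← h.eqn, pow_succ, pow_two z]
    exact ((h.ord_y.pow 2).mul_left hy).add (h.ord_z.mul_left hz)
  have hsu : p.v (Polynomial.aeval x (Polynomial.derivative s)) = 1 :=
    PoissonPlace.unit_of_isCoprime h.ord_x hs h.separable
  have ha : 0 ≤ p.a := by
    have := (p.ord_bracket hy hz).le_zero_of_unit
      (by rw [h.bracket_yz, Valuation.map_neg, hsu])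
    omega
  have hsρ : Polynomial.aeval (AdjoinRoot.root π) (Polynomial.derivative s) ≠ 0 := by
    rw [AdjoinRoot.aeval_eq, Ne, AdjoinRoot.mk_eq_zero]
    rintro ⟨q, hq⟩
    refine VanishesTo.not_one_of_unit hsu ?_
    rw [hq, map_mul, mul_comm]
    exact (PoissonPlace.ord_aeval h.ord_x q).mul_left hπ
  obtain ⟨A, B, hA, hB, rfl⟩ := exists_normalForm_z h.natDegree_le h.eqn hf
  set w : Fin 3 → (AdjoinRoot π)[X] :=
    ![Polynomial.C (AdjoinRoot.root π), -Polynomial.X ^ 2, Polynomial.X ^ 3] with hw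
  have he : aeval ![x, y, z] (triLift A + triLift B * X 2) =
      bieval x y A + bieval x y B * z := by
    simp only [map_add, map_mul, aeval_triLift, aeval_X]
    rfl
  have hφ (A : k[X][X]) : aeval w (triLift A) =
      (A.map (AdjoinRoot.mk π)).comp (-Polynomial.X ^ 2) := by
    rw [aeval_triLift, Polynomial.comp, Polynomial.eval₂_map]
    congr 1
    ext q
    · simp [hw, Polynomial.algebraMap_apply]
    · simp [hw]
  have key := PoissonPlace.X_pow_dvd_of_ord (p := p) ha
    (aeval ![x, y, z] : MvPolynomial (Fin 3) k →ₐ[k] K).toRingHom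
    (aeval w : MvPolynomial (Fin 3) k →ₐ[k] (AdjoinRoot π)[X]).toRingHom
    (fun G hG => by
      obtain ⟨c, hc, hc'⟩ := exists_const_residue (AdjoinRoot.root π) h.ord_x hy hz w hw G
      have h1 : VanishesTo p.v 1 (Polynomial.aeval x c) := by
        have := VanishesTo.sub hG hc
        simpa using this
      obtain ⟨q, rfl⟩ := PoissonPlace.dvd_of_ord_one hirr h.ord_x hπ h1
      refine Polynomial.X_dvd_iff.2 (hc'.trans ?_)
      rw [AdjoinRoot.aeval_eq, AdjoinRoot.mk_eq_zero]
      exact dvd_mul_right _ _)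
    (fun G => by
      refine ⟨hamiltonianZ s G, hamiltonianY s G,
        Polynomial.C (Polynomial.aeval (AdjoinRoot.root π) (Polynomial.derivative s))⁻¹ *
          (-2 * Polynomial.X),
        Polynomial.C (Polynomial.aeval (AdjoinRoot.root π) (Polynomial.derivative s))⁻¹ *
          (3 * Polynomial.X ^ 2), ?_, fun r hr => ⟨?_, ?_⟩⟩
      · have := derivative_cusp s (AdjoinRoot.root π) w hw G
        have hc : Polynomial.C (Polynomial.aeval (AdjoinRoot.root π) (Polynomial.derivative s))⁻¹ *
          Polynomial.C (Polynomial.aeval (AdjoinRoot.root π) (Polynomial.derivative s)) = 1 := by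
          rw [← map_mul, inv_mul_cancel₀ hsρ, map_one]
        change Polynomial.derivative (aeval w G) = _ * aeval w _ + _ * aeval w _
        linear_combination Polynomial.C (Polynomial.aeval (AdjoinRoot.root π)
          (Polynomial.derivative s))⁻¹ * this - Polynomial.derivative (aeval w G) * hc
      · have h1 := p.ord_bracket hz hr
        rw [AlgHom.toRingHom_eq_coe, RingHom.coe_coe, derivation_aeval_eq (p.bracket z)
          ![x, y, z] (hamiltonianZ s)] at h1
        · exact h1.mono (by omega)
        · intro i
          have hq : aeval ![x, y, z] (Polynomial.aeval (X 0 : MvPolynomial (Fin 3) k)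
              (Polynomial.derivative s)) = Polynomial.aeval x (Polynomial.derivative s) := by
            rw [← Polynomial.aeval_algHom_apply, aeval_X]; rfl
          fin_cases i
          · simp [hamiltonianZ, h.bracket_zx]
          · simp [hamiltonianZ, p.anti z, h.bracket_yz, hq]
          · simp [hamiltonianZ, p.bracket_self]
      · have h1 := (p.ord_bracket hy hr).neg
        rw [AlgHom.toRingHom_eq_coe, RingHom.coe_coe, ← Derivation.neg_apply,
          derivation_aeval_eq (-p.bracket y) ![x, y, z] (hamiltonianY s)] at h1
        · exact h1.mono (by omega)
        · intro i
          have hq : aeval ![x, y, z] (Polynomial.aeval (X 0 : MvPolynomial (Fin 3) k)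
              (Polynomial.derivative s)) = Polynomial.aeval x (Polynomial.derivative s) := by
            rw [← Polynomial.aeval_algHom_apply, aeval_X]; rfl
          fin_cases i
          · simp [hamiltonianY, p.anti y x, h.bracket_xy]
          · simp [hamiltonianY, p.bracket_self]
          · simp [hamiltonianY, h.bracket_yz, hq]) (m + 1)
    (triLift A + triLift B * X 2) (by
      change VanishesTo p.v _ (aeval ![x, y, z] _)
      rwa [he])
  have hval : aeval w (triLift A + triLift B * X 2) =
      (A.map (AdjoinRoot.mk π)).comp (-Polynomial.X ^ 2) +
        (B.map (AdjoinRoot.mk π)).comp (-Polynomial.X ^ 2) * Polynomial.X ^ 3 := by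
    rw [map_add, map_mul, hφ, hφ, aeval_X]
    rfl
  have hcomp (Q : k[X][X]) : ((Q.map (AdjoinRoot.mk π)).comp (-Polynomial.X ^ 2)).natDegree ≤
      2 * Q.natDegree := by
    refine Polynomial.natDegree_comp_le.trans ?_
    rw [Polynomial.natDegree_neg, Polynomial.natDegree_X_pow, mul_comm]
    exact Nat.mul_le_mul_left 2 Polynomial.natDegree_map_le
  have hzero : (A.map (AdjoinRoot.mk π)).comp (-Polynomial.X ^ 2) +
      (B.map (AdjoinRoot.mk π)).comp (-Polynomial.X ^ 2) * Polynomial.X ^ 3 = 0 := by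
    refine Polynomial.eq_zero_of_dvd_of_natDegree_lt (hval ▸ key) ?_
    rw [Polynomial.natDegree_X_pow]
    refine Nat.lt_succ_of_le (Polynomial.natDegree_add_le_of_degree_le ?_ ?_)
    · rcases eq_or_ne A 0 with h0 | h0
      · simp [h0]
      · have := hA.natDegree_le h0
        refine (hcomp A).trans ?_
        push_cast at this
        omega
    · rcases eq_or_ne B 0 with h0 | h0
      · simp [h0]
      · have := hB.natDegree_le h0
        refine Polynomial.natDegree_mul_le.trans ?_
        have := hcomp B
        rw [Polynomial.natDegree_X_pow]
        push_cast at *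
        omega
  obtain ⟨a0, b0⟩ := eq_zero_of_comp_add hzero
  exact exists_factor_of_normalForm_z hirr.natDegree_pos hA hB
    (C_dvd_iff_map_mk_eq_zero.2 a0) (C_dvd_iff_map_mk_eq_zero.2 b0)

/-- An element of weight at most `m + 1` vanishing to order more than `(m + 1) * a` at a place
lying over the point `π = 0` of the `x`-line is divisible by `π`. -/
lemma exists_factor (h : IsChart p s x y z) (hirr : Irreducible π)
    (hπ : VanishesTo p.v 1 (Polynomial.aeval x π)) {f : K}
    (hf : f ∈ weightSpan k x y z (m + 1)) (hord : VanishesTo p.v ((m + 1 : ℕ) * p.a + 1) f) :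
    ∃ f' ∈ weightSpan k x y z m, f = Polynomial.aeval x π * f' := by
  rcases (VanishesTo.zero_iff.1 h.ord_z).eq_or_lt with hz | hz
  · exact h.exists_factor_of_unit_z hirr hπ hz hf hord
  rcases (VanishesTo.zero_iff.1 h.ord_y).eq_or_lt with hy | hy
  · exact h.exists_factor_of_unit_y hirr hπ hy hf hord
  exact h.exists_factor_of_cusp hirr hπ (VanishesTo.one_iff.2 hy) (VanishesTo.one_iff.2 hz) hf hord

end IsChart

/-- Multiply the bracket of a place by an element of order `-ω`. -/
def PoissonPlace.scale {k K : Type*} [Field k] [Field K] [Algebra k K] (p : PoissonPlace k K)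
    (c : K) (ω : ℤ) (hc : VanishesTo p.v (-ω) c) : PoissonPlace k K where
  v := p.v
  map_const := p.map_const
  bracket f := c • p.bracket f
  anti f g := by simp [p.anti f g]
  a := p.a + ω
  ord_bracket hf hg := (hc.mul (p.ord_bracket hf hg)).mono (by linarith)

/-- Coordinates on the surface `x ^ 5 + y ^ 3 + z ^ 2 = t` with its Hamiltonian bracket. -/
structure IsE8Place {k K : Type*} [Field k] [Field K] [Algebra k K] (p : PoissonPlace k K)
    (t : k) (x y z : K) : Prop where
  eqn : x ^ 5 + y ^ 3 + z ^ 2 = algebraMap k K t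
  bracket_xy : p.bracket x y = 2 * z
  bracket_zx : p.bracket z x = 3 * y ^ 2
  bracket_yz : p.bracket y z = 5 * x ^ 4
  ne_zero : t ≠ 0

section weightSpanInv

variable {k K : Type*} [Field k] [Field K] [Algebra k K] {x y z : K}

lemma mul_inv_pow_mem_weightSpan (hx : x ≠ 0) {n : ℕ} {f : K} (hf : f ∈ weightSpan k x y z n) :
    f * x⁻¹ ^ n ∈ weightSpan k x⁻¹ (y * x⁻¹ ^ 2) (z * x⁻¹ ^ 3) n := by
  induction hf using Submodule.span_induction with
  | mem f hf =>
    obtain ⟨i, j, l, h, rfl⟩ := hf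
    obtain ⟨d, rfl⟩ := Nat.exists_eq_add_of_le h
    have : x ^ i * y ^ j * z ^ l * x⁻¹ ^ (i + 2 * j + 3 * l + d) =
        x⁻¹ ^ d * (y * x⁻¹ ^ 2) ^ j * (z * x⁻¹ ^ 3) ^ l := by
      have hi : x ^ i * x⁻¹ ^ i = 1 := by rw [← mul_pow, mul_inv_cancel₀ hx, one_pow]
      rw [pow_add, pow_add, pow_add, pow_mul, pow_mul, mul_pow, mul_pow]
      linear_combination (y ^ j * z ^ l * (x⁻¹ ^ 2) ^ j * (x⁻¹ ^ 3) ^ l * x⁻¹ ^ d) * hi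
    rw [this]
    exact monomial_mem_weightSpan (by omega)
  | zero => simp
  | add f g _ _ hf hg => rw [add_mul]; exact Submodule.add_mem _ hf hg
  | smul c f _ hf => rw [smul_mul_assoc]; exact Submodule.smul_mem _ _ hf

lemma mul_pow_mem_weightSpan (hx : x ≠ 0) {n : ℕ} {f : K}
    (hf : f ∈ weightSpan k x⁻¹ (y * x⁻¹ ^ 2) (z * x⁻¹ ^ 3) n) :
    f * x ^ n ∈ weightSpan k x y z n := by
  have := mul_inv_pow_mem_weightSpan (inv_ne_zero hx) hf
  rw [inv_inv, mul_assoc, mul_assoc, ← mul_pow, ← mul_pow, inv_mul_cancel₀ hx] at this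
  simpa using this

end weightSpanInv

namespace IsE8Place

variable {k K : Type*} [Field k] [Field K] [Algebra k K]
variable {p : PoissonPlace k K} {t : k} {x y z : K} {m : ℕ}

lemma derivative_affine : Polynomial.derivative (Polynomial.C t - Polynomial.X ^ 5) =
    -(5 * Polynomial.X ^ 4) := by
  rw [Polynomial.derivative_sub, Polynomial.derivative_C, Polynomial.derivative_X_pow, zero_sub]
  simp only [Nat.cast_ofNat, map_ofNat]

lemma derivative_inv :
    Polynomial.derivative (Polynomial.C t * Polynomial.X ^ 6 - Polynomial.X) =
      6 * Polynomial.C t * Polynomial.X ^ 5 - 1 := by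
  rw [Polynomial.derivative_sub, Polynomial.derivative_C_mul, Polynomial.derivative_X_pow,
    Polynomial.derivative_X]
  simp only [Nat.cast_ofNat, map_ofNat]
  ring

variable [CharZero k]

lemma C_inv_five_mul : (Polynomial.C (5⁻¹ : k)) * 5 = 1 := by
  rw [← map_ofNat Polynomial.C 5, ← map_mul, inv_mul_cancel₀ (by norm_num), map_one]

lemma isChart (h : IsE8Place p t x y z) (hx : VanishesTo p.v 0 x) (hy : VanishesTo p.v 0 y)
    (hz : VanishesTo p.v 0 z) : IsChart p (Polynomial.C t - Polynomial.X ^ 5) x y z where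
  eqn := by
    simp only [map_sub, map_pow, Polynomial.aeval_C, Polynomial.aeval_X]
    linear_combination h.eqn
  natDegree_le := by compute_degree!
  separable := by
    refine ⟨Polynomial.C t⁻¹, -Polynomial.C 5⁻¹ * Polynomial.C t⁻¹ * Polynomial.X, ?_⟩
    have h1 : Polynomial.C t⁻¹ * Polynomial.C t = 1 := by
      rw [← map_mul, inv_mul_cancel₀ h.ne_zero, map_one]
    rw [derivative_affine]
    linear_combination h1 + Polynomial.C t⁻¹ * Polynomial.X ^ 5 * C_inv_five_mul (k := k)
  bracket_xy := h.bracket_xy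
  bracket_zx := h.bracket_zx
  bracket_yz := by
    rw [h.bracket_yz, derivative_affine]
    simp only [map_neg, map_mul, map_pow, map_ofNat, Polynomial.aeval_X, neg_neg]
  ord_x := hx
  ord_y := hy
  ord_z := hz

/-- The chart at `x = ∞`. -/
lemma isChart_inv (h : IsE8Place p t x y z) {w : K} (hw : x * w = 1) {ω : ℤ}
    (hc : VanishesTo p.v (-ω) (-x)) (hx : VanishesTo p.v 0 w)
    (hy : VanishesTo p.v 0 (y * w ^ 2)) (hz : VanishesTo p.v 0 (z * w ^ 3)) :
    IsChart (p.scale (-x) ω hc) (Polynomial.C t * Polynomial.X ^ 6 - Polynomial.X)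
      w (y * w ^ 2) (z * w ^ 3) := by
  have hfw (f : K) : p.bracket f w = -w ^ 2 * p.bracket f x := by
    rw [eq_inv_of_mul_eq_one_right hw, Derivation.leibniz_inv, smul_eq_mul]
  have hwf (f : K) : p.bracket w f = -w ^ 2 * p.bracket x f := by
    rw [p.anti, hfw, p.anti x f]; ring
  have hxz : p.bracket x z = -(3 * y ^ 2) := by rw [p.anti, h.bracket_zx]
  have hzy : p.bracket z y = -(5 * x ^ 4) := by rw [p.anti, h.bracket_yz]
  have hww : p.bracket w w = 0 := p.bracket_self w
  have hpow (f : K) (n : ℕ) : p.bracket f (w ^ (n + 1)) = (n + 1) * w ^ n * p.bracket f w := by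
    rw [Derivation.leibniz_pow]; simp [mul_assoc]
  refine ⟨?_, by compute_degree!, ?_, ?_, ?_, ?_, hx, hy, hz⟩
  · simp only [map_sub, map_mul, map_pow, Polynomial.aeval_C, Polynomial.aeval_X]
    linear_combination w ^ 6 * h.eqn -
      w * (1 + x * w + (x * w) ^ 2 + (x * w) ^ 3 + (x * w) ^ 4) * hw
  · refine ⟨-36 * Polynomial.C t * Polynomial.X ^ 4 * Polynomial.C 5⁻¹,
      -1 + 6 * Polynomial.C t * Polynomial.X ^ 5 * Polynomial.C 5⁻¹, ?_⟩
    rw [derivative_inv]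
    linear_combination 6 * Polynomial.C t * Polynomial.X ^ 5 * C_inv_five_mul (k := k)
  · change -x * p.bracket w (y * w ^ 2) = _
    rw [Derivation.leibniz, hpow, hww, hwf y, h.bracket_xy, smul_eq_mul, smul_eq_mul]
    linear_combination 2 * z * w ^ 3 * hw
  · change -x * p.bracket (z * w ^ 3) w = _
    rw [p.anti, Derivation.leibniz, hpow, hww, hwf z, hxz, smul_eq_mul, smul_eq_mul]
    linear_combination 3 * y ^ 2 * w ^ 4 * hw
  · change -x * p.bracket (y * w ^ 2) (z * w ^ 3) = _
    have h1 : p.bracket (y * w ^ 2) w = 2 * z * w ^ 4 := by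
      rw [p.anti, Derivation.leibniz, hpow, hww, hwf y, h.bracket_xy, smul_eq_mul, smul_eq_mul]
      ring
    have h2 : p.bracket (y * w ^ 2) z = 6 * y ^ 3 * w ^ 3 + 5 * x ^ 4 * w ^ 2 := by
      rw [p.anti, Derivation.leibniz, hpow, hfw, h.bracket_zx, hzy, smul_eq_mul, smul_eq_mul]
      push_cast
      ring
    rw [Derivation.leibniz, hpow, h1, h2, derivative_inv, smul_eq_mul, smul_eq_mul]
    simp only [map_sub, map_mul, map_pow, map_ofNat, map_one, Polynomial.aeval_C,
      Polynomial.aeval_X]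
    push_cast
    linear_combination (-6 * x * w ^ 6) * h.eqn + (-6 * algebraMap k K t * w ^ 5 +
      6 * (1 + x * w + (x * w) ^ 2 + (x * w) ^ 3 + (x * w) ^ 4 + (x * w) ^ 5) -
      5 * (1 + x * w + (x * w) ^ 2 + (x * w) ^ 3 + (x * w) ^ 4)) * hw

/-- Vanishing along a place over `x = ∞` where `y / x ^ 2` and `z / x ^ 3` are regular forces
the weight to drop. -/
lemma mem_weightSpan_of_one_lt (h : IsE8Place p t x y z) (hx : 1 < p.v x)
    (hy : p.v y ≤ p.v x ^ 2) (hz : p.v z ≤ p.v x ^ 3) {f : K}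
    (hf : f ∈ weightSpan k x y z (m + 1)) (hord : VanishesTo p.v ((m + 1 : ℕ) * p.a + 1) f) :
    f ∈ weightSpan k x y z m := by
  have hx0 : x ≠ 0 := fun h0 => by simp [h0] at hx
  have hv0 : p.v x ≠ 0 := (p.v.ne_zero_iff).2 hx0
  obtain ⟨ω, hω⟩ := VanishesTo.exists_exact (v := p.v) (inv_ne_zero hx0)
  have hc : VanishesTo p.v (-ω) (-x) := by
    rw [VanishesTo, Valuation.map_neg, ← inv_inv x, map_inv₀, hω, ← WithZero.exp_neg]
  have hle (f : K) (n : ℕ) (hf : p.v f ≤ p.v x ^ n) : VanishesTo p.v 0 (f * x⁻¹ ^ n) := by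
    rw [VanishesTo.zero_iff, map_mul, map_pow, map_inv₀, inv_pow]
    exact mul_inv_le_one_of_le₀ hf zero_le
  have hx1 : VanishesTo p.v 1 x⁻¹ := by
    rw [VanishesTo.one_iff, map_inv₀]
    exact inv_lt_one_of_one_lt₀ hx
  have hch := h.isChart_inv (mul_inv_cancel₀ hx0) hc (hx1.mono zero_le_one) (hle y 2 hy)
    (hle z 3 hz)
  have hpow (n : ℕ) : VanishesTo p.v (n * ω) (x⁻¹ ^ n) := by
    rw [VanishesTo, map_pow, hω, ← WithZero.exp_nsmul]
    simp
  obtain ⟨f', hf', e⟩ := hch.exists_factor (π := Polynomial.X) Polynomial.irreducible_X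
    (by rw [Polynomial.aeval_X]; exact hx1) (mul_inv_pow_mem_weightSpan hx0 hf)
    ((hord.mul (hpow (m + 1))).mono (by
      change ((m + 1 : ℕ) : ℤ) * (p.a + ω) + 1 ≤ _
      linarith))
  have : f = f' * x ^ m := by
    rw [Polynomial.aeval_X] at e
    have h1 : x⁻¹ * x = 1 := inv_mul_cancel₀ hx0
    have h2 : x⁻¹ ^ (m + 1) * x ^ (m + 1) = 1 := by rw [← mul_pow, h1, one_pow]
    rw [pow_succ x] at h2
    linear_combination x ^ (m + 1) * e - f * h2 + f' * x ^ m * h1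
  rw [this]
  exact mul_pow_mem_weightSpan hx0 hf'

end IsE8Place

section homogenize

variable {k : Type*} [Field k]

/-- The weighted homogenization of a polynomial in `x, y` (of weights `1, 2`) to weight `n`;
the three variables are `x`, the homogenizing variable and `y`. -/
def homogenization (n : ℤ) (A : k[X][X]) : MvPolynomial (Fin 3) k :=
  ∑ j ∈ A.support, ∑ i ∈ (A.coeff j).support,
    C ((A.coeff j).coeff i) * (X 0 ^ i * X 1 ^ (n - i - 2 * j).toNat * X 2 ^ j)

variable {n : ℤ} {A : k[X][X]}

lemma aeval_homogenization {K : Type*} [Field K] [Algebra k K] (hA : Wt 2 n A) {x w y : K}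
    (hw : w ≠ 0) :
    aeval ![x, w, y] (homogenization n A) = w ^ n * bieval (w⁻¹ * x) (w⁻¹ ^ 2 * y) A := by
  rw [bieval_eq_sum, homogenization, map_sum, Finset.mul_sum]
  refine Finset.sum_congr rfl fun j _ => ?_
  rw [map_sum, Finset.mul_sum]
  refine Finset.sum_congr rfl fun i hi => ?_
  have h := hA j i (Polynomial.mem_support_iff.1 hi)
  obtain ⟨d, hd⟩ := Int.eq_ofNat_of_zero_le (a := n - i - 2 * j) (by push_cast at h; linarith)
  have hn : n = d + i + 2 * j := by linarith
  have e : w ^ n * ((w⁻¹ * x) ^ i * (w⁻¹ ^ 2 * y) ^ j) = x ^ i * w ^ d * y ^ j := by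
    have h1 : w ^ i * w⁻¹ ^ i = 1 := by rw [← mul_pow, mul_inv_cancel₀ hw, one_pow]
    have h2 : (w ^ 2) ^ j * (w⁻¹ ^ 2) ^ j = 1 := by
      rw [← mul_pow, ← mul_pow, mul_inv_cancel₀ hw, one_pow, one_pow]
    have h3 : w ^ n = w ^ d * w ^ i * (w ^ 2) ^ j := by
      rw [hn, zpow_add₀ hw, zpow_add₀ hw, zpow_mul]
      norm_cast
    rw [h3, mul_pow, mul_pow]
    linear_combination (w ^ d * x ^ i * y ^ j) * h1 + (w ^ d * x ^ i * y ^ j * w ^ i * w⁻¹ ^ i) * h2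
  rw [hd, Int.toNat_natCast, mul_smul_comm, e, Algebra.smul_def]
  simp

lemma coeff_homogenization_infinity (i₀ : ℕ) :
    (aeval ![Polynomial.X, 0, -1] (homogenization n A) : k[X]).coeff i₀ =
      ∑ j ∈ A.support, if n - i₀ - 2 * j ≤ 0 then (A.coeff j).coeff i₀ * (-1) ^ j else 0 := by
  rw [homogenization, map_sum, Polynomial.finsetSum_coeff]
  refine Finset.sum_congr rfl fun j _ => ?_
  rw [map_sum, Polynomial.finsetSum_coeff]
  have e (i : ℕ) : (aeval ![Polynomial.X, 0, -1] (C ((A.coeff j).coeff i) *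
      (X 0 ^ i * X 1 ^ (n - i - 2 * j).toNat * X 2 ^ j)) : k[X]).coeff i₀ =
      if i = i₀ then (if n - i₀ - 2 * j ≤ 0 then (A.coeff j).coeff i₀ * (-1) ^ j else 0)
        else 0 := by
    have h1 : (aeval ![Polynomial.X, 0, -1] (C ((A.coeff j).coeff i) *
      (X 0 ^ i * X 1 ^ (n - i - 2 * j).toNat * X 2 ^ j)) : k[X]) =
      Polynomial.C ((A.coeff j).coeff i * (0 ^ (n - i - 2 * j).toNat * (-1) ^ j)) *
        Polynomial.X ^ i := by
      simp
      ring
    rw [h1, Polynomial.coeff_C_mul_X_pow]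
    by_cases hi : i = i₀
    · subst hi
      rw [if_pos rfl, if_pos rfl, zero_pow_eq]
      simp only [Int.toNat_eq_zero]
      split_ifs <;> ring
    · rw [if_neg (Ne.symm hi), if_neg hi]
  simp only [e]
  rw [Finset.sum_ite_eq']
  split_ifs with h1 h2 h2
  · rfl
  · rfl
  · rw [Polynomial.notMem_support_iff.1 h1, zero_mul]
  · rfl

lemma coeff_homogenization_of_eq (hA : Wt 2 n A) {i j : ℕ} (h : (i : ℤ) + 2 * j = n) :
    (aeval ![Polynomial.X, 0, -1] (homogenization n A) : k[X]).coeff i =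
      (A.coeff j).coeff i * (-1) ^ j := by
  rw [coeff_homogenization_infinity, Finset.sum_eq_single j]
  · rw [if_pos (by omega)]
  · intro l _ hl
    split_ifs with h1
    · by_cases hc : (A.coeff l).coeff i = 0
      · rw [hc, zero_mul]
      · have := hA l i hc
        omega
    · rfl
  · intro hj
    rw [Polynomial.notMem_support_iff.1 hj]
    simp

lemma coeff_homogenization_of_ne (hA : Wt 2 n A) {i : ℕ} (h : ∀ j : ℕ, (i : ℤ) + 2 * j ≠ n) :
    (aeval ![Polynomial.X, 0, -1] (homogenization n A) : k[X]).coeff i = 0 := by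
  rw [coeff_homogenization_infinity]
  refine Finset.sum_eq_zero fun l _ => ?_
  split_ifs with h1
  · by_cases hc : (A.coeff l).coeff i = 0
    · rw [hc, zero_mul]
    · have := hA l i hc
      have := h l
      omega
  · rfl

/-- The vector field `y (2 + 3 y) ∂/∂x - 5 x ^ 4 w ∂/∂y`. -/
def infinityField : Derivation k (MvPolynomial (Fin 3) k) (MvPolynomial (Fin 3) k) :=
  mkDerivation k ![X 2 * (2 + 3 * X 2), 0, -5 * X 0 ^ 4 * X 1]

lemma derivative_infinity (G : MvPolynomial (Fin 3) k) :
    Polynomial.derivative (aeval ![Polynomial.X, 0, -1] G : k[X]) =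
      aeval ![Polynomial.X, 0, -1] (infinityField G) := by
  induction G using MvPolynomial.induction_on with
  | C a =>
    rw [← MvPolynomial.algebraMap_eq, Derivation.map_algebraMap]
    simp
  | add f g hf hg => simp only [map_add, hf, hg]
  | mul_X f i hf =>
    simp only [map_mul, Derivation.leibniz, smul_eq_mul, map_add,
      Polynomial.derivative_mul, aeval_X, hf]
    fin_cases i
    · simp [infinityField]
      ring
    · simp [infinityField]
    · simp [infinityField]

end homogenize

namespace IsE8Place

variable {k K : Type*} [Field k] [Field K] [Algebra k K]
variable {p : PoissonPlace k K} {t : k} {x y z : K} {m : ℕ}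

lemma exists_const_residue {x w y : K} (hx : VanishesTo p.v 1 x)
    (hw : VanishesTo p.v 1 w) (hy : VanishesTo p.v 1 (y + 1)) (G : MvPolynomial (Fin 3) k) :
    VanishesTo p.v 1 (aeval ![x, w, y] G -
      algebraMap k K ((aeval ![Polynomial.X, 0, -1] G : k[X]).coeff 0)) := by
  have hy0 : VanishesTo p.v 0 y := by
    have h1 : VanishesTo p.v 0 (1 : K) := by simpa using p.ord_const (1 : k)
    have := (hy.mono zero_le_one).sub h1
    simpa using this
  induction G using MvPolynomial.induction_on with
  | C a =>
    simpa [Polynomial.algebraMap_apply] using VanishesTo.zero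
  | add f g hf hg =>
    convert hf.add hg using 1
    simp only [map_add, Polynomial.coeff_add]; ring
  | mul_X f i hf =>
    have hf0 : VanishesTo p.v 0 (aeval ![x, w, y] f) := by
      have := (hf.mono zero_le_one).add
        (p.ord_const ((aeval ![Polynomial.X, 0, -1] f : k[X]).coeff 0))
      simpa using this
    fin_cases i
    · simpa using hf0.mul_left hx
    · simpa using hf0.mul_left hw
    · have := (hf0.mul_left hy).sub hf
      simp only [map_mul, aeval_X, Polynomial.mul_coeff_zero]
      convert this using 1
      simp
      ring

variable [CharZero k]

/-- Vanishing along a place over the point at infinity of the cuspidal fibre at `x = ∞` forces the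
weight to drop. -/
lemma mem_weightSpan_of_infinity (h : IsE8Place p t x y z) (hy0 : y ≠ 0) (hz0 : z ≠ 0)
    (hw : VanishesTo p.v 1 (y / z)) (hx : VanishesTo p.v 1 (x * y / z))
    (hy : VanishesTo p.v 1 (y ^ 3 / z ^ 2 + 1)) {f : K}
    (hf : f ∈ weightSpan k x y z (m + 1)) (hord : VanishesTo p.v ((m + 1 : ℕ) * p.a + 1) f) :
    f ∈ weightSpan k x y z m := by
  have hw0 : y / z ≠ 0 := div_ne_zero hy0 hz0
  obtain ⟨ω, hω⟩ := VanishesTo.exists_exact (v := p.v) hw0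
  have hω1 : 1 ≤ ω := by
    have := hw
    rw [VanishesTo, hω, WithZero.exp_le_exp] at this
    omega
  have hxz : p.bracket x z = -(3 * y ^ 2) := by rw [p.anti, h.bracket_zx]
  set w := y / z with hwdef
  have hy1 : p.v (y ^ 3 / z ^ 2) = 1 := by
    have e : y ^ 3 / z ^ 2 = (y ^ 3 / z ^ 2 + 1) - 1 := by ring
    rw [e, Valuation.map_sub_eq_of_lt_right _ (by
      rw [map_one]; exact VanishesTo.one_iff.1 hy), map_one]
  have hwy : p.bracket w y = y / z ^ 2 * (5 * x ^ 4) := by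
    rw [p.anti, hwdef, Derivation.leibniz_div, p.bracket_self, h.bracket_yz]
    simp only [smul_eq_mul]
    field_simp
    ring
  have hwx : p.bracket w x = -(2 + 3 * (y ^ 3 / z ^ 2)) := by
    rw [p.anti, hwdef, Derivation.leibniz_div, h.bracket_xy, hxz]
    simp only [smul_eq_mul]
    field_simp
    ring
  set E : Derivation k K K := (-(y ^ 3 / z ^ 2) / w) • p.bracket w with hE
  have hEw : E w = 0 := by rw [hE]; simp [p.bracket_self]
  have hEx : E (x * y / z) = y ^ 3 / z ^ 2 * (2 + 3 * (y ^ 3 / z ^ 2)) := by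
    have e : x * y / z = x * w := by rw [hwdef]; ring
    rw [e, Derivation.leibniz, hEw, smul_zero, zero_add, hE, Derivation.smul_apply, hwx,
      smul_eq_mul, smul_eq_mul]
    field_simp
  have hEy : E (y ^ 3 / z ^ 2) = -5 * (x * y / z) ^ 4 * w := by
    have e : y ^ 3 / z ^ 2 = y * w ^ 2 := by rw [hwdef]; field_simp
    rw [e, Derivation.leibniz, Derivation.leibniz_pow, hEw, hE, Derivation.smul_apply, hwy]
    simp only [smul_eq_mul, mul_zero, smul_zero, zero_add, hwdef]
    field_simp
  have hEord (r : ℤ) (g : K) (hg : VanishesTo p.v r g) : VanishesTo p.v (r - 1 - p.a) (E g) := by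
    have h1 : VanishesTo p.v (-ω) (-(y ^ 3 / z ^ 2) / w) := by
      rw [VanishesTo, map_div₀, Valuation.map_neg, hy1, hω, one_div, ← WithZero.exp_neg]
    have h2 : VanishesTo p.v ω w := hω.le
    exact (h1.mul (p.ord_bracket h2 hg)).mono (by linarith)
  have ha : 0 ≤ p.a := by
    have := (hEord 1 _ hx).le_zero_of_unit (by
      have e : 2 + 3 * (y ^ 3 / z ^ 2) = 3 * (y ^ 3 / z ^ 2 + 1) - 1 := by ring
      rw [hEx, map_mul, hy1, one_mul, e, Valuation.map_sub_eq_of_lt_right _ (by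
        rw [map_one, map_mul, p.valuation_ofNat, one_mul]; exact VanishesTo.one_iff.1 hy),
        map_one])
    omega
  obtain ⟨A, B, hA, hB, rfl⟩ := exists_normalForm_z (s := Polynomial.C t - Polynomial.X ^ 5)
    (by compute_degree!) (by
      simp only [map_sub, map_pow, Polynomial.aeval_C, Polynomial.aeval_X]
      linear_combination h.eqn) hf
  set G := homogenization (m + 1 : ℕ) A + homogenization ((m + 1 : ℕ) - 3) B * X 2 with hG
  have he : aeval ![x * y / z, w, y ^ 3 / z ^ 2] G =
      (bieval x y A + bieval x y B * z) * w ^ (m + 1) := by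
    have e1 : w⁻¹ * (x * y / z) = x := by rw [hwdef]; field_simp
    have e2 : w⁻¹ ^ 2 * (y ^ 3 / z ^ 2) = y := by rw [hwdef]; field_simp
    have e3 : w ^ (((m + 1 : ℕ) : ℤ) - 3) * (y ^ 3 / z ^ 2) = z * w ^ (m + 1) := by
      rw [zpow_sub₀ hw0, zpow_natCast, hwdef]
      norm_cast
      field_simp
    rw [hG, map_add, map_mul, aeval_homogenization hA hw0, aeval_homogenization hB hw0, e1, e2,
      zpow_natCast, aeval_X]
    change _ + _ * (y ^ 3 / z ^ 2) = _
    linear_combination bieval x y B * e3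
  have key := PoissonPlace.X_pow_dvd_of_ord (p := p) (b := p.a + ω) (by omega)
    (aeval ![x * y / z, w, y ^ 3 / z ^ 2] : MvPolynomial (Fin 3) k →ₐ[k] K).toRingHom
    (aeval ![Polynomial.X, 0, -1] : MvPolynomial (Fin 3) k →ₐ[k] k[X]).toRingHom
    (fun G hG => by
      have h1 := VanishesTo.sub hG (exists_const_residue hx hw hy G)
      rw [AlgHom.toRingHom_eq_coe, RingHom.coe_coe, sub_sub_cancel] at h1
      rw [Polynomial.X_dvd_iff]
      by_contra hne
      exact VanishesTo.not_one_of_unit (p.map_const _ hne) h1)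
    (fun G => by
      refine ⟨infinityField G, 0, 1, 0, ?_, fun r hr => ⟨?_, ?_⟩⟩
      · rw [one_mul, zero_mul, add_zero]
        exact derivative_infinity G
      · have h1 := hEord _ _ hr
        rw [AlgHom.toRingHom_eq_coe, RingHom.coe_coe, IsChart.derivation_aeval_eq E
          ![x * y / z, w, y ^ 3 / z ^ 2] infinityField] at h1
        · exact h1.mono (by omega)
        · intro i
          fin_cases i
          · simp [infinityField, hEx]
          · simp [infinityField, hEw]
          · simp [infinityField, hEy]
      · rw [map_zero]; exact VanishesTo.zero) (m + 1) G (by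
      change VanishesTo p.v _ (aeval ![x * y / z, w, y ^ 3 / z ^ 2] G)
      rw [he]
      have hpow : VanishesTo p.v ((m + 1 : ℕ) * ω) (w ^ (m + 1)) := by
        rw [VanishesTo, map_pow, hω, ← WithZero.exp_nsmul]
        simp
      exact (hord.mul hpow).mono (by linarith))
  rw [Polynomial.X_pow_dvd_iff] at key
  have hcoef (i : ℕ) (hi : i ≤ m + 1) :
      (aeval ![Polynomial.X, 0, -1] (homogenization (m + 1 : ℕ) A) : k[X]).coeff i =
      (aeval ![Polynomial.X, 0, -1] (homogenization ((m + 1 : ℕ) - 3) B) : k[X]).coeff i := by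
    have := key i (by omega)
    rw [AlgHom.toRingHom_eq_coe, RingHom.coe_coe, hG, map_add, map_mul, aeval_X] at this
    simpa [← sub_eq_add_neg, sub_eq_zero] using this
  have hA' : Wt 2 m A := by
    intro j i hc
    have h1 := hA j i hc
    by_contra hlt
    have h2 : (i : ℤ) + 2 * j = (m + 1 : ℕ) := by push_cast at *; omega
    have h3 := hcoef i (by omega)
    rw [coeff_homogenization_of_eq hA h2, coeff_homogenization_of_ne hB (by intro l; omega)] at h3
    exact hc ((mul_eq_zero.1 h3).resolve_right (pow_ne_zero _ (by simp)))
  have hB' : Wt 2 (m - 3) B := by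
    intro j i hc
    have h1 := hB j i hc
    by_contra hlt
    have h2 : (i : ℤ) + 2 * j = (m + 1 : ℕ) - 3 := by push_cast at *; omega
    have h3 := hcoef i (by omega)
    rw [coeff_homogenization_of_eq hB h2, coeff_homogenization_of_ne hA (by intro l; omega)] at h3
    exact hc ((mul_eq_zero.1 h3.symm).resolve_right (pow_ne_zero _ (by simp)))
  have hAm := bieval_mul_mem_weightSpan (x := x) (y := y) (z := z) (n := m) (l := 0)
    (hA'.mono (by simp))
  have hBm := bieval_mul_mem_weightSpan (x := x) (y := y) (z := z) (n := m) (l := 1)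
    (hB'.mono (by simp))
  simpa using Submodule.add_mem _ hAm hBm

end IsE8Place

namespace IsE8Place

variable {k K : Type*} [Field k] [Field K] [Algebra k K] [CharZero k]
variable {p : PoissonPlace k K} {t : k} {x y z : K}

/-- Either the coordinates are regular at the place, or high vanishing at the place lowers the
weight. -/
lemma regular_or_mem_weightSpan (h : IsE8Place p t x y z) :
    (VanishesTo p.v 0 x ∧ VanishesTo p.v 0 y ∧ VanishesTo p.v 0 z) ∨
      ∀ (m : ℕ) (f : K), f ∈ weightSpan k x y z (m + 1) →
        VanishesTo p.v ((m + 1 : ℕ) * p.a + 1) f → f ∈ weightSpan k x y z m := by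
  set M := max 1 (p.v x) with hM
  have hM1 : 1 ≤ M := le_max_left _ _
  have hxM : p.v x ≤ M := le_max_right _ _
  by_cases hYZ : p.v y ≤ M ^ 2 ∧ p.v z ≤ M ^ 3
  · obtain ⟨hY, hZ⟩ := hYZ
    rcases le_or_gt (p.v x) 1 with hx | hx
    · rw [hM, max_eq_left hx, one_pow] at hY hZ
      exact Or.inl ⟨VanishesTo.zero_iff.2 hx, VanishesTo.zero_iff.2 hY, VanishesTo.zero_iff.2 hZ⟩
    · rw [hM, max_eq_right hx.le] at hY hZ
      exact Or.inr fun m f hf hord => h.mem_weightSpan_of_one_lt hx hY hZ hf hord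
  · have hsum : p.v (y ^ 3 + z ^ 2) ≤ M ^ 6 := by
      have e : y ^ 3 + z ^ 2 = algebraMap k K t - x ^ 5 := by linear_combination h.eqn
      rw [e]
      refine p.v.map_sub_le ?_ ?_
      · exact (VanishesTo.zero_iff.1 (p.ord_const t)).trans (one_le_pow₀ hM1)
      · rw [map_pow]
        exact (pow_le_pow_left' hxM 5).trans (pow_le_pow_right₀ hM1 (by norm_num))
    have hgt : M ^ 6 < max (p.v (y ^ 3)) (p.v (z ^ 2)) := by
      rw [lt_max_iff, map_pow, map_pow]
      by_contra! hc
      refine hYZ ⟨?_, ?_⟩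
      · refine le_of_pow_le_pow_left₀ (n := 3) (by norm_num) zero_le ?_
        rw [← pow_mul]; exact hc.1
      · refine le_of_pow_le_pow_left₀ (n := 2) (by norm_num) zero_le ?_
        rw [← pow_mul]; exact hc.2
    have heq : p.v (y ^ 3) = p.v (z ^ 2) := by
      by_contra hne
      rw [p.v.map_add_of_distinct_val hne] at hsum
      exact hgt.not_ge hsum
    rw [heq, max_self] at hgt
    have hZ6 : M ^ 6 < p.v y ^ 3 := by rwa [← map_pow, heq]
    have h16 : (1 : ℤᵐ⁰) ≤ M ^ 6 := one_le_pow₀ hM1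
    have hy0 : y ≠ 0 := fun h0 => by simp [h0] at hZ6
    have hz0 : z ≠ 0 := fun h0 => by simp [h0] at hgt
    have hvy : 0 < p.v y := zero_lt_iff.2 ((p.v.ne_zero_iff).2 hy0)
    have hvz : 0 < p.v z := zero_lt_iff.2 ((p.v.ne_zero_iff).2 hz0)
    rw [map_pow, map_pow] at heq
    have hXY : p.v x * p.v y < p.v z := by
      by_contra! hc
      have h1 : p.v y ^ 2 * p.v y ≤ p.v y ^ 2 * p.v x ^ 2 := by
        calc p.v y ^ 2 * p.v y = p.v z ^ 2 := by rw [← heq, pow_succ _ 2]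
          _ ≤ (p.v x * p.v y) ^ 2 := pow_le_pow_left' hc 2
          _ = _ := by rw [mul_pow, mul_comm]
      have h2 : p.v y ≤ p.v x ^ 2 := le_of_mul_le_mul_left h1 (pow_pos hvy 2)
      have h3 : p.v y ^ 3 ≤ M ^ 6 := by
        refine (pow_le_pow_left' h2 3).trans ?_
        rw [← pow_mul]
        exact pow_le_pow_left' hxM 6
      exact hZ6.not_ge h3
    have hY : p.v y < p.v z := by
      by_contra! hc
      have h1 : p.v y ^ 2 * p.v y ≤ p.v y ^ 2 * 1 := by
        calc p.v y ^ 2 * p.v y = p.v z ^ 2 := by rw [← heq, pow_succ _ 2]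
          _ ≤ p.v y ^ 2 := pow_le_pow_left' hc 2
          _ = _ := by rw [mul_one]
      have h2 : p.v y ≤ 1 := le_of_mul_le_mul_left h1 (pow_pos hvy 2)
      exact hZ6.not_ge ((pow_le_one' h2 3).trans h16)
    refine Or.inr fun m f hf hord => h.mem_weightSpan_of_infinity hy0 hz0 ?_ ?_ ?_ hf hord
    · rw [VanishesTo.one_iff, map_div₀, div_lt_one₀ hvz]
      exact hY
    · rw [VanishesTo.one_iff, map_div₀, map_mul, div_lt_one₀ hvz]
      exact hXY
    · have e : y ^ 3 / z ^ 2 + 1 = (y ^ 3 + z ^ 2) / z ^ 2 := by field_simp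
      rw [VanishesTo.one_iff, e, map_div₀, map_pow, div_lt_one₀ (pow_pos hvz 2), ← map_pow]
      exact hsum.trans_lt hgt

end IsE8Place

namespace IsE8Place

variable {k K : Type*} [Field k] [Field K] [Algebra k K]
variable {p : PoissonPlace k K} {t : k} {x y z : K}

lemma exists_bieval_of_mem_weightSpan (h : IsE8Place p t x y z) (hz : VanishesTo p.v 0 z)
    (hx : VanishesTo p.v 0 x) (hy : VanishesTo p.v 0 y) {n : ℕ} {f : K}
    (hf : f ∈ weightSpan k x y z n)
    (hf0 : f ≠ 0) (hf1 : VanishesTo p.v 1 f) :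
    ∃ P : k[X][X], P ≠ 0 ∧ VanishesTo p.v 1 (bieval x y P) := by
  obtain ⟨A, B, -, -, rfl⟩ := exists_normalForm_z (s := Polynomial.C t - Polynomial.X ^ 5)
    (by compute_degree!) (by
      simp only [map_sub, map_pow, Polynomial.aeval_C, Polynomial.aeval_X]
      linear_combination h.eqn) hf
  refine ⟨A ^ 2 - B ^ 2 * (Polynomial.C (Polynomial.C t - Polynomial.X ^ 5) - Polynomial.X ^ 3),
    fun h0 => hf0 ?_, ?_⟩
  · have hinj : Function.Injective (Polynomial.map (algebraMap k[X] (FractionRing k[X]))) :=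
      Polynomial.map_injective _ (IsFractionRing.injective _ _)
    have h1 := congrArg (Polynomial.map (algebraMap k[X] (FractionRing k[X]))) h0
    rw [Polynomial.map_sub, Polynomial.map_mul, Polynomial.map_pow, Polynomial.map_pow,
      Polynomial.map_sub, Polynomial.map_C, Polynomial.map_pow, Polynomial.map_X,
      Polynomial.map_zero, sub_eq_zero] at h1
    obtain ⟨hA, hB⟩ := eq_zero_of_quadratic_norm _ h1
    rw [Polynomial.map_eq_zero_iff (IsFractionRing.injective _ _)] at hA hB
    rw [hA, hB, map_zero, zero_mul, add_zero]
  · have e : bieval x y (A ^ 2 - B ^ 2 * (Polynomial.C (Polynomial.C t - Polynomial.X ^ 5) -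
        Polynomial.X ^ 3)) =
        (bieval x y A - bieval x y B * z) * (bieval x y A + bieval x y B * z) := by
      simp only [map_sub, map_mul, map_pow, bieval_C, bieval_X, Polynomial.aeval_C,
        Polynomial.aeval_X]
      linear_combination bieval x y B ^ 2 * h.eqn
    rw [e]
    exact ((PoissonPlace.ord_bieval hx hy A).sub
      ((PoissonPlace.ord_bieval hx hy B).mul_left hz)).mul_left hf1

variable [CharZero k]

/-- A place whose centre is a curve dominating the `x`-line has nonnegative discrepancy. -/
lemma a_nonneg (h : IsE8Place p t x y z) (hx : VanishesTo p.v 0 x) (hy : VanishesTo p.v 0 y)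
    (hz : VanishesTo p.v 0 z)
    (htriv : ∀ c : k[X], c ≠ 0 → p.v (Polynomial.aeval x c) = 1) {n : ℕ} {f : K}
    (hf : f ∈ weightSpan k x y z n) (hf0 : f ≠ 0) (hf1 : VanishesTo p.v 1 f) : 0 ≤ p.a := by
  by_contra! ha
  have hord {g : K} (hg : VanishesTo p.v 1 g) : VanishesTo p.v 1 (p.bracket x g) :=
    (p.ord_bracket hx hg).mono (by omega)
  have hz1 : p.v z = 1 := by
    refine le_antisymm (VanishesTo.zero_iff.1 hz) (le_of_not_gt fun hlt => ?_)
    have hz1 := VanishesTo.one_iff.2 hlt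
    have h1 := VanishesTo.one_iff.1 (hord hz1)
    rw [p.anti, h.bracket_zx, Valuation.map_neg, map_mul, p.valuation_ofNat, one_mul, map_pow] at h1
    have hy1 : VanishesTo p.v 1 (y ^ 2) := by rwa [VanishesTo.one_iff, map_pow]
    refine VanishesTo.not_one_of_unit (htriv (Polynomial.C t - Polynomial.X ^ 5) fun h0 => ?_) ?_
    · have := congrArg (Polynomial.eval 0) h0
      simp at this
      exact h.ne_zero this
    · have e : Polynomial.aeval x (Polynomial.C t - Polynomial.X ^ 5) = y * y ^ 2 + z * z := by
        simp only [map_sub, map_pow, Polynomial.aeval_C, Polynomial.aeval_X]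
        linear_combination -h.eqn
      rw [e]
      exact (hy.mul_left hy1).add (hz.mul_left hz1)
  obtain ⟨P, hP0, hP⟩ := h.exists_bieval_of_mem_weightSpan hz hx hy hf hf0 hf1
  induction hd : P.natDegree using Nat.strong_induction_on generalizing P with
  | _ d ih =>
    rcases Nat.eq_zero_or_pos d with rfl | hpos
    · rw [Polynomial.eq_C_of_natDegree_eq_zero hd, bieval_C] at hP
      refine VanishesTo.not_one_of_unit (htriv _ fun h0 => hP0 ?_) hP
      rw [Polynomial.eq_C_of_natDegree_eq_zero hd, h0, map_zero]
    · have hlt := Polynomial.natDegree_derivative_lt (p := P) (by omega)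
      refine ih _ (hd ▸ hlt) (Polynomial.derivative P) (fun h0 => ?_) ?_ rfl
      · have := Polynomial.derivative_eq_zero.1 h0
        omega
      · have h1 := hord hP
        rw [derivation_bieval x y _ (p.bracket_self x), h.bracket_xy] at h1
        refine VanishesTo.of_mul_unit ?_ h1
        rw [map_mul, hz1, p.valuation_ofNat, one_mul]

end IsE8Place

section fractionRing

variable {k R K : Type*} [Field k] [CommRing R] [Field K] [Algebra k K]
  [Algebra R K] [IsFractionRing R K]

open TensorProduct in
lemma exists_derivation_of_isFractionRing [Algebra k R] [IsScalarTower k R K]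
    (D : Derivation k R K) : ∃ E : Derivation k K K, ∀ r, E (algebraMap R K r) = D r := by
  have : Algebra.FormallyEtale R K := .of_isLocalization (nonZeroDivisors R)
  let φ : K ⊗[R] Ω[R⁄k] →ₗ[K] K := LinearMap.liftBaseChange K D.liftKaehlerDifferential
  refine ⟨(φ ∘ₗ (KaehlerDifferential.tensorKaehlerEquivOfFormallyEtale k R K).symm.toLinearMap
    ).compDer (KaehlerDifferential.D k K), fun r => ?_⟩
  simp [φ, KaehlerDifferential.tensorKaehlerEquivOfFormallyEtale_symm_D_algebraMap]

variable [IsDomain R]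

lemma ord_derivation_of_isFractionRing {v : Valuation K ℤᵐ⁰} {D : Derivation k K K} {e : ℤ}
    (h : ∀ (r : ℤ) (a : R), VanishesTo v r (algebraMap R K a) →
      VanishesTo v (r + e) (D (algebraMap R K a))) {r : ℤ} {f : K} (hf : VanishesTo v r f) :
    VanishesTo v (r + e) (D f) := by
  obtain ⟨a, c, hc, rfl⟩ := IsFractionRing.div_surjective (A := R) f
  have hc0 : algebraMap R K c ≠ 0 := IsFractionRing.to_map_ne_zero_of_mem_nonZeroDivisors hc
  obtain ⟨σ, hσ⟩ := VanishesTo.exists_exact (v := v) hc0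
  have hcσ : VanishesTo v σ (algebraMap R K c) := hσ.le
  have ha : VanishesTo v (r + σ) (algebraMap R K a) := by
    have := hf.mul hcσ
    rwa [div_mul_cancel₀ _ hc0] at this
  have hinv : VanishesTo v (-2 * σ) ((algebraMap R K c)⁻¹ ^ 2) := by
    rw [VanishesTo, map_pow, map_inv₀, hσ, ← WithZero.exp_neg, ← WithZero.exp_nsmul]
    simp
  rw [Derivation.leibniz_div]
  simp only [smul_eq_mul]
  refine (hinv.mul (((hcσ.mul (h _ _ ha)).mono (r := r + 2 * σ + e) ?_).sub
    ((ha.mul (h _ _ hcσ)).mono ?_))).mono ?_ <;> linarith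

/-- A bound for the order of a bracket only has to be checked on integral elements. -/
lemma ord_bracket_of_isFractionRing {v : Valuation K ℤᵐ⁰} {B : K → Derivation k K K}
    (anti : ∀ f g, B f g = -B g f) {e : ℤ}
    (h : ∀ (r s : ℤ) (a b : R), VanishesTo v r (algebraMap R K a) →
      VanishesTo v s (algebraMap R K b) →
      VanishesTo v (r + s + e) (B (algebraMap R K a) (algebraMap R K b)))
    {r s : ℤ} {f g : K} (hf : VanishesTo v r f) (hg : VanishesTo v s g) :
    VanishesTo v (r + s + e) (B f g) := by
  have h1 (b : R) (s : ℤ) (hb : VanishesTo v s (algebraMap R K b)) (r : ℤ) (f : K)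
      (hf : VanishesTo v r f) : VanishesTo v (r + (s + e)) (B (algebraMap R K b) f) :=
    ord_derivation_of_isFractionRing (fun r a ha => (h _ _ _ _ hb ha).mono (by linarith)) hf
  refine (ord_derivation_of_isFractionRing (R := R) (e := r + e) (fun s b hb => ?_) hg).mono
    (by linarith)
  rw [anti]
  exact ((h1 b s hb r f hf).mono (by linarith)).neg

variable (K) in
lemma exists_valuation_of_isFractionRing (ord : R → ℤ)
    (hmul : ∀ a b, a ≠ 0 → b ≠ 0 → ord (a * b) = ord a + ord b)
    (hadd : ∀ a b, a ≠ 0 → b ≠ 0 → a + b ≠ 0 → min (ord a) (ord b) ≤ ord (a + b)) :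
    ∃ v : Valuation K ℤᵐ⁰, ∀ r, r ≠ 0 → v (algebraMap R K r) = WithZero.exp (-ord r) := by
  classical
  let w : Valuation R ℤᵐ⁰ :=
    { toFun r := if r = 0 then 0 else WithZero.exp (-ord r)
      map_zero' := if_pos rfl
      map_one' := by
        have := hmul 1 1 one_ne_zero one_ne_zero
        rw [mul_one] at this
        have h0 : ord 1 = 0 := by linarith
        rw [if_neg one_ne_zero, h0, neg_zero, WithZero.exp_zero]
      map_mul' a b := by
        by_cases ha : a = 0
        · simp [ha]
        by_cases hb : b = 0
        · simp [hb]
        rw [if_neg ha, if_neg hb, if_neg (mul_ne_zero ha hb), hmul a b ha hb, neg_add,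
          WithZero.exp_add]
      map_add_le_max' a b := by
        by_cases ha : a = 0
        · simp [ha]
        by_cases hb : b = 0
        · simp [hb]
        by_cases hab : a + b = 0
        · simp [hab]
        simp only [if_neg ha, if_neg hb, if_neg hab]
        rw [le_max_iff, WithZero.exp_le_exp, WithZero.exp_le_exp, neg_le_neg_iff, neg_le_neg_iff]
        exact min_le_iff.1 (hadd a b ha hb hab) }
  have hw (r : R) (hr : r ≠ 0) : w r = WithZero.exp (-ord r) := if_neg hr
  have hS : nonZeroDivisors R ≤ w.supp.primeCompl := fun r hr hr' => by
    rw [SetLike.mem_coe, Valuation.mem_supp_iff, hw r (nonZeroDivisors.ne_zero hr)] at hr'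
    exact WithZero.exp_ne_zero hr'
  refine ⟨w.extendToLocalization hS K, fun r hr => ?_⟩
  rw [Valuation.extendToLocalization_apply_map_apply, hw r hr]

variable (K) in
lemma exists_valuation_of_prime [UniqueFactorizationMonoid R] {q : R} (hq : Prime q) :
    ∃ v : Valuation K ℤᵐ⁰, ∀ (n : ℕ) (r : R), VanishesTo v n (algebraMap R K r) ↔ q ^ n ∣ r := by
  have hfin {a : R} (ha : a ≠ 0) : FiniteMultiplicity q a := .of_not_isUnit hq.not_isUnit ha
  obtain ⟨v, hv⟩ := exists_valuation_of_isFractionRing K (fun r : R => (multiplicity q r : ℤ))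
    (fun a b ha hb => by
      rw [multiplicity_mul hq (hfin (mul_ne_zero ha hb)), Nat.cast_add])
    (fun a b ha hb hab => by
      rw [← Nat.cast_min, Nat.cast_le, ← (hfin hab).pow_dvd_iff_le_multiplicity]
      exact dvd_add
        (((hfin ha).pow_dvd_iff_le_multiplicity).2 (min_le_left _ _))
        (((hfin hb).pow_dvd_iff_le_multiplicity).2 (min_le_right _ _)))
  refine ⟨v, fun n r => ?_⟩
  by_cases hr : r = 0
  · simp [hr, VanishesTo.zero]
  · rw [VanishesTo, hv r hr, WithZero.exp_le_exp, (hfin hr).pow_dvd_iff_le_multiplicity]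
    omega

end fractionRing

section places

variable {k R K : Type*} [Field k] [CommRing R] [IsDomain R] [Algebra k R] [Field K] [Algebra k K]
  [Algebra R K] [IsScalarTower k R K] [IsFractionRing R K]

/-- The adic place of a prime element. -/
lemma exists_poissonPlace_of_prime [UniqueFactorizationMonoid R] {B : K → Derivation k K K}
    (anti : ∀ f g, B f g = -B g f) (self : ∀ f, B f f = 0)
    (hB : ∀ a b : R, ∃ c : R, B (algebraMap R K a) (algebraMap R K b) = algebraMap R K c)
    {q : R} (hq : Prime q) :
    ∃ p : PoissonPlace k K, p.bracket = B ∧ p.a = 0 ∧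
      ∀ (n : ℕ) (r : R), VanishesTo p.v n (algebraMap R K r) ↔ q ^ n ∣ r := by
  obtain ⟨v, hv⟩ := exists_valuation_of_prime K hq
  have hreg (r : R) : VanishesTo v 0 (algebraMap R K r) := by
    have := (hv 0 r).2 (by simp)
    exact_mod_cast this
  have hreg' (a b : R) : VanishesTo v 0 (B (algebraMap R K a) (algebraMap R K b)) := by
    obtain ⟨c, hc⟩ := hB a b
    rw [hc]; exact hreg c
  have hconst (c : k) : VanishesTo v 0 (algebraMap k K c) := by
    rw [IsScalarTower.algebraMap_apply k R K]; exact hreg _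
  have hpow (n : ℕ) : VanishesTo v n (algebraMap R K q ^ n) := by
    rw [← map_pow]; exact (hv n _).2 dvd_rfl
  have hpow' (n : ℕ) : VanishesTo v (n - 1) ((n : K) * algebraMap R K q ^ (n - 1)) := by
    rcases n with _ | n
    · simpa using VanishesTo.zero
    · have := hconst ((n + 1 : ℕ) : k)
      rw [map_natCast] at this
      exact (this.mul_left (hpow n)).mono (by simp)
  have hdvd (r : ℤ) (a : R) (ha : VanishesTo v r (algebraMap R K a)) : q ^ r.toNat ∣ a := by
    refine (hv _ _).1 ?_
    rcases le_total 0 r with h | h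
    · rwa [Int.toNat_of_nonneg h]
    · rw [Int.toNat_of_nonpos h]
      exact_mod_cast hreg a
  refine ⟨⟨v, fun c hc => ?_, B, anti, 0, fun {r s f g} hf hg => ?_⟩, rfl, rfl, hv⟩
  · refine le_antisymm (VanishesTo.zero_iff.1 (hconst c)) ?_
    have := VanishesTo.zero_iff.1 (hconst c⁻¹)
    rw [map_inv₀, map_inv₀] at this
    refine (inv_le_one₀ ?_).1 this
    exact zero_lt_iff.2 ((v.ne_zero_iff).2 ((map_ne_zero _).2 hc))
  · refine (ord_bracket_of_isFractionRing (R := R) anti (e := -1) (fun r s a b ha hb => ?_) hf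
      hg).mono (by linarith)
    obtain ⟨u, rfl⟩ := hdvd r a ha
    obtain ⟨w, rfl⟩ := hdvd s b hb
    set n := r.toNat with hn
    set m := s.toNat with hm
    have hnr : r ≤ n := Int.self_le_toNat r
    have hms : s ≤ m := Int.self_le_toNat s
    simp only [map_mul, map_pow]
    have e : B (algebraMap R K q ^ n * algebraMap R K u) (algebraMap R K q ^ m * algebraMap R K w) =
        algebraMap R K q ^ n * algebraMap R K q ^ m * B (algebraMap R K u) (algebraMap R K w) +
        (n * algebraMap R K q ^ (n - 1)) * algebraMap R K q ^ m *
          (algebraMap R K u * B (algebraMap R K q) (algebraMap R K w)) +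
        algebraMap R K q ^ n * (m * algebraMap R K q ^ (m - 1)) *
          (algebraMap R K w * B (algebraMap R K u) (algebraMap R K q)) := by
      have hl (f g h : K) : B (f * g) h = f * B g h + g * B f h := by
        rw [anti, Derivation.leibniz, smul_eq_mul, smul_eq_mul, anti h, anti h]; ring
      have hp (f h : K) (n : ℕ) : B (f ^ n) h = n * f ^ (n - 1) * B f h := by
        rw [anti, Derivation.leibniz_pow, anti h]
        simp [mul_assoc]
      rw [hl, Derivation.leibniz, Derivation.leibniz, hp, hp, Derivation.leibniz_pow,
        Derivation.leibniz_pow, self]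
      simp only [smul_eq_mul, nsmul_eq_mul]
      ring
    rw [e]
    refine VanishesTo.add (VanishesTo.add ?_ ?_) ?_
    · exact (((hpow n).mul (hpow m)).mul (hreg' u w)).mono (by linarith)
    · exact (((hpow' n).mul (hpow m)).mul ((hreg u).mul_left (hreg' q w))).mono (by linarith)
    · exact (((hpow n).mul (hpow' m)).mul ((hreg w).mul_left (hreg' u q))).mono (by linarith)

end places

section jacobian

variable {k K : Type*} [Field k] [Field K] [Algebra k K]

/-- The bracket attached to two derivations. -/
def jacobianBracket (D₁ D₂ : Derivation k K K) (f : K) : Derivation k K K :=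
  D₁ f • D₂ - D₂ f • D₁

lemma jacobianBracket_apply (D₁ D₂ : Derivation k K K) (f g : K) :
    jacobianBracket D₁ D₂ f g = D₁ f * D₂ g - D₂ f * D₁ g := rfl

variable {σ : Type*} [Algebra (MvPolynomial σ k) K]
  [IsScalarTower k (MvPolynomial σ k) K] [IsFractionRing (MvPolynomial σ k) K]

lemma min_neg_totalDegree_le (a b : MvPolynomial σ k) :
    min (-(a.totalDegree : ℤ)) (-(b.totalDegree : ℤ)) ≤ -((a + b).totalDegree : ℤ) := by
  have := totalDegree_add a b
  omega

/-- The place at infinity of the affine plane. -/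
lemma exists_poissonPlace_totalDegree {D₁ D₂ : Derivation k K K} {i j : σ}
    (h₁ : ∀ r : MvPolynomial σ k, D₁ (algebraMap _ K r) = algebraMap _ K (pderiv i r))
    (h₂ : ∀ r : MvPolynomial σ k, D₂ (algebraMap _ K r) = algebraMap _ K (pderiv j r)) :
    ∃ p : PoissonPlace k K, p.bracket = jacobianBracket D₁ D₂ ∧ p.a = -3 ∧
      ∀ r : MvPolynomial σ k, r ≠ 0 →
        p.v (algebraMap _ K r) = WithZero.exp (r.totalDegree : ℤ) := by
  obtain ⟨v, hv⟩ := exists_valuation_of_isFractionRing K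
    (fun r : MvPolynomial σ k => -(r.totalDegree : ℤ))
    (fun a b ha hb => by rw [totalDegree_mul_of_isDomain ha hb]; push_cast; ring)
    (fun a b _ _ _ => min_neg_totalDegree_le a b)
  simp only [neg_neg] at hv
  have hD (i : σ) (r : ℤ) (a : MvPolynomial σ k) (ha : VanishesTo v r (algebraMap _ K a)) :
      VanishesTo v (r + 1) (algebraMap _ K (pderiv i a)) := by
    rw [a.as_sum, map_sum, map_sum]
    refine VanishesTo.sum fun m hm => ?_
    rw [pderiv_monomial]
    by_cases hc : a.coeff m * (m i : k) = 0
    · rw [hc, map_zero, map_zero]; exact VanishesTo.zero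
    · have hmi : m i ≠ 0 := fun h0 => by simp [h0] at hc
      have ha0 : a ≠ 0 := fun h0 => by simp [h0] at hm
      rw [VanishesTo, hv a ha0, WithZero.exp_le_exp] at ha
      rw [VanishesTo, hv _ (by rwa [Ne, monomial_eq_zero]), WithZero.exp_le_exp,
        totalDegree_monomial _ hc]
      have h1 := le_totalDegree hm
      have h2 : (m - Finsupp.single i 1).degree + 1 = m.degree := by
        conv_rhs => rw [← tsub_add_cancel_of_le
          (Finsupp.single_le_iff.2 (Nat.one_le_iff_ne_zero.2 hmi))]
        rw [map_add, Finsupp.degree_single]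
      change (((m - Finsupp.single i 1).degree : ℕ) : ℤ) ≤ _
      change m.degree ≤ _ at h1
      omega
  refine ⟨⟨v, fun c hc => ?_, jacobianBracket D₁ D₂, fun f g => ?_, -3, fun {r s f g} hf hg => ?_⟩,
    rfl, rfl, hv⟩
  · rw [IsScalarTower.algebraMap_apply k (MvPolynomial σ k) K, hv _ (by simpa using hc)]
    simp [MvPolynomial.algebraMap_eq]
  · simp only [jacobianBracket_apply]; ring
  · have hE₁ {r : ℤ} {f : K} (hf : VanishesTo v r f) : VanishesTo v (r + 1) (D₁ f) :=
      ord_derivation_of_isFractionRing (fun r a ha => by rw [h₁]; exact hD i r a ha) hf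
    have hE₂ {r : ℤ} {f : K} (hf : VanishesTo v r f) : VanishesTo v (r + 1) (D₂ f) :=
      ord_derivation_of_isFractionRing (fun r a ha => by rw [h₂]; exact hD j r a ha) hf
    rw [jacobianBracket_apply]
    exact (((hE₁ hf).mul (hE₂ hg)).mono (by linarith)).sub
      (((hE₂ hf).mul (hE₁ hg)).mono (by linarith))

end jacobian

section transcendence

/-- If `φ` is injective modulo `I` and `c ∈ I` is nonzero modulo a smaller prime ideal `J`, then
adjoining `c` to the image of `φ` is free modulo `J`. -/
lemma eq_zero_of_eval₂_mem {P A : Type*} [CommRing P] [CommRing A] (φ : P →+* A)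
    {I J : Ideal A} [J.IsPrime] (hJI : J ≤ I) (hφ : ∀ b, φ b ∈ I → b = 0) {c : A} (hcI : c ∈ I)
    (hcJ : c ∉ J) (H : P[X]) (hH : Polynomial.eval₂RingHom φ c H ∈ J) : H = 0 := by
  induction hd : H.natDegree using Nat.strong_induction_on generalizing H with
  | _ d ih =>
    have h0 : H.coeff 0 = 0 := by
      refine hφ _ ?_
      have e := congrArg (Polynomial.eval₂RingHom φ c) (Polynomial.divX_mul_X_add H)
      simp only [map_add, map_mul, Polynomial.coe_eval₂RingHom, Polynomial.eval₂_X,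
        Polynomial.eval₂_C] at e hH
      rw [eq_sub_of_add_eq' e]
      exact I.sub_mem (hJI hH) (I.mul_mem_left _ hcI)
    have e := Polynomial.divX_mul_X_add H
    rw [h0, map_zero, add_zero] at e
    rcases Nat.eq_zero_or_pos d with rfl | hpos
    · rw [Polynomial.eq_C_of_natDegree_eq_zero hd, h0, map_zero]
    · have h1 : H.divX = 0 := by
        refine ih _ ?_ _ ?_ rfl
        · rw [Polynomial.natDegree_divX_eq_natDegree_tsub_one]; omega
        · rw [← e, map_mul] at hH
          refine (Ideal.IsPrime.mem_or_mem ‹_› hH).resolve_right ?_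
          simpa using hcJ
      rw [← e, h1, zero_mul]

set_option maxSynthPendingDepth 6 in
lemma not_injective_of_four_variables {F : Type*} [Field F]
    (ψ : F[X][X][X][X] →ₐ[F] MvPolynomial (Fin 3) F) : ¬ Function.Injective ψ := by
  intro hψ
  have h := trdeg_le_of_injective ψ hψ
  have e1 : Algebra.trdeg F F[X][X] = 1 + 1 := by
    rw [← trdeg_add_eq F F[X], Polynomial.trdeg_of_isDomain, Polynomial.trdeg_of_isDomain]
  have e2 : Algebra.trdeg F F[X][X][X] = 1 + 1 + 1 := by
    rw [← trdeg_add_eq F F[X][X], e1, Polynomial.trdeg_of_isDomain]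
  rw [← trdeg_add_eq F F[X][X][X], e2, Polynomial.trdeg_of_isDomain,
    MvPolynomial.trdeg_of_isDomain] at h
  norm_num at h

end transcendence

section clearing

variable (k A : Type*) {K : Type*} [Field k] [CommRing A] [Field K] [Algebra k K] [Algebra A K]

/-- The elements of `K` that become integral over `A` after multiplication by a nonzero element of
`k` that is integral over `A`. -/
def integralUpToConstants
    (hk : ∀ c : k, ∃ b : k, b ≠ 0 ∧ ∃ e u : A, algebraMap A K e = algebraMap k K b ∧
      algebraMap A K u = algebraMap k K b * algebraMap k K c) : Subalgebra k K where
  carrier := {f | ∃ b : k, b ≠ 0 ∧ ∃ e u : A, algebraMap A K e = algebraMap k K b ∧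
      algebraMap A K u = algebraMap k K b * f}
  algebraMap_mem' := hk
  mul_mem' := by
    rintro f g ⟨b, hb, e, u, he, hu⟩ ⟨b', hb', e', u', he', hu'⟩
    refine ⟨b * b', mul_ne_zero hb hb', e * e', u * u', ?_, ?_⟩
    · rw [map_mul, map_mul, he, he']
    · rw [map_mul, map_mul, hu, hu']; ring
  add_mem' := by
    rintro f g ⟨b, hb, e, u, he, hu⟩ ⟨b', hb', e', u', he', hu'⟩
    refine ⟨b * b', mul_ne_zero hb hb', e * e', u * e' + u' * e, ?_, ?_⟩
    · rw [map_mul, map_mul, he, he']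
    · rw [map_add, map_mul, map_mul, map_mul, hu, hu', he, he']; ring

variable {k A}
variable {hk : ∀ c : k, ∃ b : k, b ≠ 0 ∧ ∃ e u : A, algebraMap A K e = algebraMap k K b ∧
      algebraMap A K u = algebraMap k K b * algebraMap k K c}

lemma algebraMap_mem_integralUpToConstants (u : A) :
    algebraMap A K u ∈ integralUpToConstants k A hk :=
  ⟨1, one_ne_zero, 1, u, by simp, by simp⟩

lemma weightSpan_le_integralUpToConstants (x y z : A) (n : ℕ) :
    weightSpan k (algebraMap A K x) (algebraMap A K y) (algebraMap A K z) n ≤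
      Subalgebra.toSubmodule (integralUpToConstants k A hk) := by
  refine Submodule.span_le.2 ?_
  rintro _ ⟨i, j, l, -, rfl⟩
  change _ ∈ integralUpToConstants k A hk
  exact mul_mem (mul_mem (pow_mem (algebraMap_mem_integralUpToConstants x) i)
    (pow_mem (algebraMap_mem_integralUpToConstants y) j))
    (pow_mem (algebraMap_mem_integralUpToConstants z) l)

end clearing

section

variable {A K : Type*} [CommRing A] [UniqueFactorizationMonoid A] [Field K] [Algebra A K]

lemma exists_prime_dvd_of_valuation_lt_one {v : Valuation K ℤᵐ⁰}
    (hA : ∀ a : A, v (algebraMap A K a) ≤ 1) {u : A} (hu : u ≠ 0)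
    (h : v (algebraMap A K u) < 1) :
    ∃ P : A, Prime P ∧ P ∣ u ∧ v (algebraMap A K P) < 1 := by
  induction u using UniqueFactorizationMonoid.induction_on_prime with
  | h₁ => exact absurd rfl hu
  | h₂ u hunit =>
    obtain ⟨w, hw⟩ := hunit.exists_right_inv
    have h1 : v (algebraMap A K u) * v (algebraMap A K w) = 1 := by
      rw [← map_mul, ← map_mul, hw, map_one, map_one]
    exact absurd h1 (mul_lt_one_of_lt_of_le h (hA w)).ne
  | h₃ a P ha hP ih =>
    rcases lt_or_eq_of_le (hA P) with h1 | h1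
    · exact ⟨P, hP, dvd_mul_right _ _, h1⟩
    · rw [map_mul, map_mul, h1, one_mul] at h
      obtain ⟨Q, hQ, hQa, hQv⟩ := ih ha h
      exact ⟨Q, hQ, hQa.mul_left _, hQv⟩

end

section coordinates

variable {F k K : Type*} [Field F] [Field k] [Field K] [Algebra F k] [Algebra F K]
  [Algebra k K] [IsScalarTower F k K] [Algebra (MvPolynomial (Fin 3) F) K]
  [IsScalarTower F (MvPolynomial (Fin 3) F) K]

lemma mul_mem_weightSpan {x y z f : K} {n : ℕ} (hf : f ∈ weightSpan k x y z n) :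
    f * x ∈ weightSpan k x y z (n + 3) ∧ f * y ∈ weightSpan k x y z (n + 3) ∧
      f * z ∈ weightSpan k x y z (n + 3) := by
  induction hf using Submodule.span_induction with
  | mem f hf =>
    obtain ⟨i, j, l, h, rfl⟩ := hf
    refine ⟨?_, ?_, ?_⟩
    · convert monomial_mem_weightSpan (k := k) (i := i + 1) (j := j) (l := l) _ using 1
      · ring
      · omega
    · convert monomial_mem_weightSpan (k := k) (i := i) (j := j + 1) (l := l) _ using 1
      · ring
      · omega
    · convert monomial_mem_weightSpan (k := k) (i := i) (j := j) (l := l + 1) _ using 1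
      · ring
      · omega
  | zero => simp
  | add f g _ _ hf hg =>
    simp only [add_mul]
    exact ⟨add_mem hf.1 hg.1, add_mem hf.2.1 hg.2.1, add_mem hf.2.2 hg.2.2⟩
  | smul c f _ hf =>
    simp only [smul_mul_assoc]
    exact ⟨Submodule.smul_mem _ _ hf.1, Submodule.smul_mem _ _ hf.2.1,
      Submodule.smul_mem _ _ hf.2.2⟩

variable (k) in
lemma exists_mem_weightSpan (u : MvPolynomial (Fin 3) F) :
    ∃ n, algebraMap _ K u ∈ weightSpan k (algebraMap (MvPolynomial (Fin 3) F) K (X 0))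
      (algebraMap (MvPolynomial (Fin 3) F) K (X 1))
      (algebraMap (MvPolynomial (Fin 3) F) K (X 2)) n := by
  induction u using MvPolynomial.induction_on with
  | C a =>
    refine ⟨0, ?_⟩
    have h1 := monomial_mem_weightSpan (k := k)
      (x := algebraMap (MvPolynomial (Fin 3) F) K (X 0))
      (y := algebraMap (MvPolynomial (Fin 3) F) K (X 1))
      (z := algebraMap (MvPolynomial (Fin 3) F) K (X 2)) (n := 0) (i := 0) (j := 0) (l := 0) le_rfl
    have h2 := Submodule.smul_mem _ (algebraMap F k a) h1
    rw [← MvPolynomial.algebraMap_eq, ← IsScalarTower.algebraMap_apply,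
      IsScalarTower.algebraMap_apply F k K]
    simpa [Algebra.smul_def] using h2
  | add f g hf hg =>
    obtain ⟨n, hn⟩ := hf
    obtain ⟨m, hm⟩ := hg
    rw [map_add]
    exact ⟨max n m, add_mem (weightSpan_mono (le_max_left _ _) hn)
      (weightSpan_mono (le_max_right _ _) hm)⟩
  | mul_X f i hf =>
    obtain ⟨n, hn⟩ := hf
    obtain ⟨h0, h1, h2⟩ := mul_mem_weightSpan hn
    refine ⟨n + 3, ?_⟩
    rw [map_mul]
    fin_cases i
    exacts [h0, h1, h2]

variable {p : PoissonPlace k K}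

lemma PoissonPlace.ord_algebraMap_mvPolynomial
    (h : ∀ i, VanishesTo p.v 0 (algebraMap (MvPolynomial (Fin 3) F) K (X i)))
    (u : MvPolynomial (Fin 3) F) : VanishesTo p.v 0 (algebraMap _ K u) := by
  induction u using MvPolynomial.induction_on with
  | C a =>
    rw [← MvPolynomial.algebraMap_eq, ← IsScalarTower.algebraMap_apply,
      IsScalarTower.algebraMap_apply F k K]
    exact p.ord_const _
  | add f g hf hg => rw [map_add]; exact hf.add hg
  | mul_X f i hf => rw [map_mul]; exact hf.mul_left (h i)

end coordinates

section localContradiction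

lemma IsE8Place.aeval_ne_zero {k K : Type*} [Field k] [CharZero k] [Field K] [Algebra k K]
    {p : PoissonPlace k K} {t : k} {x y z : K} (h : IsE8Place p t x y z) (hz : z ≠ 0) {π : k[X]}
    (hπ : Irreducible π) : Polynomial.aeval x π ≠ 0 := by
  intro h0
  have : CharZero K := charZero_of_injective_algebraMap (algebraMap k K).injective
  have h1 : Polynomial.aeval x (Polynomial.derivative π) * p.bracket y x = 0 := by
    rw [← smul_eq_mul, ← Derivation.map_aeval, h0, map_zero]
  have h2 : p.bracket y x ≠ 0 := by
    rw [p.anti, h.bracket_xy]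
    simpa using hz
  obtain ⟨a, b, hab⟩ := hπ.separable
  have h3 := congrArg (Polynomial.aeval x) hab
  simp [h0, (mul_eq_zero.1 h1).resolve_right h2] at h3

variable {F k K : Type*} [Field F] [Field k] [Field K]
  [Algebra k K] [Algebra (MvPolynomial (Fin 3) F) K]
  {p : PoissonPlace k K}

local notation "ι" => algebraMap (MvPolynomial (Fin 3) F) K

/-- Three polynomials without common factor cannot all be divisible by a nonconstant polynomial in
`x` over the field of constants. -/
lemma exists_prime_dvd_of_eq_mul [IsFractionRing (MvPolynomial (Fin 3) F) K]
    (hk : ∀ c : k, ∃ b : k, b ≠ 0 ∧ ∃ e u : MvPolynomial (Fin 3) F,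
      ι e = algebraMap k K b ∧ ι u = algebraMap k K b * algebraMap k K c)
    (hreg : ∀ u : MvPolynomial (Fin 3) F, p.v (ι u) ≤ 1) {π : k[X]}
    (hπ0 : Polynomial.aeval (ι (X 0)) π ≠ 0)
    (hπ : VanishesTo p.v 1 (Polynomial.aeval (ι (X 0)) π))
    {f : Fin 3 → MvPolynomial (Fin 3) F} {n : ℕ}
    (hf : ∀ i, ∃ f' ∈ weightSpan k (ι (X 0)) (ι (X 1)) (ι (X 2)) n,
      ι (f i) = Polynomial.aeval (ι (X 0)) π * f') :
    ∃ P, Prime P ∧ ∀ i, P ∣ f i := by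
  have hinj : Function.Injective ι := IsFractionRing.injective _ _
  have hπm : Polynomial.aeval (ι (X 0)) π ∈ integralUpToConstants k (MvPolynomial (Fin 3) F) hk :=
    Polynomial.aeval_mem_adjoin_singleton k (ι (X 0)) |> fun h =>
      Algebra.adjoin_le (by simpa using algebraMap_mem_integralUpToConstants (X 0)) h
  obtain ⟨b, hb, e, u, he, hu⟩ := hπm
  have hu0 : u ≠ 0 := fun h0 => by
    rw [h0, map_zero] at hu
    exact mul_ne_zero ((map_ne_zero _).2 hb) hπ0 hu.symm
  have hu1 : p.v (ι u) < 1 := by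
    rw [hu, map_mul, p.map_const b hb, one_mul]
    exact VanishesTo.one_iff.1 hπ
  obtain ⟨P, hP, hPu, hPv⟩ := exists_prime_dvd_of_valuation_lt_one hreg hu0 hu1
  have hunit (c : k) (hc : c ≠ 0) (d : MvPolynomial (Fin 3) F) (hd : ι d = algebraMap k K c) :
      ¬ P ∣ d := by
    rintro ⟨d', rfl⟩
    have h1 := p.map_const c hc
    rw [← hd, map_mul, map_mul] at h1
    exact (mul_lt_one_of_lt_of_le hPv (hreg d')).ne h1
  refine ⟨P, hP, fun i => ?_⟩
  obtain ⟨f', hf', hfi⟩ := hf i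
  obtain ⟨b', hb', e', u', he', hu'⟩ := weightSpan_le_integralUpToConstants (hk := hk) _ _ _ _ hf'
  have key : e * e' * f i = u * u' := by
    apply hinj
    simp only [map_mul]
    rw [he, he', hu, hu', hfi]
    ring
  have h1 : P ∣ e * e' * f i := by rw [key]; exact hPu.mul_right _
  rcases hP.dvd_or_dvd h1 with h2 | h2
  · rcases hP.dvd_or_dvd h2 with h3 | h3
    · exact absurd h3 (hunit b hb e he)
    · exact absurd h3 (hunit b' hb' e' he')
  · exact h2

variable [Algebra F k] [Algebra F K] [IsScalarTower F k K]
  [IsScalarTower F (MvPolynomial (Fin 3) F) K]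

set_option maxSynthPendingDepth 6 in
/-- A place of `K` trivial on polynomials in `x` and `t` has a centre of codimension one. -/
lemma dvd_of_valuation_lt_one (hreg : ∀ u : MvPolynomial (Fin 3) F, p.v (ι u) ≤ 1)
    {t : k} (ht : Transcendental F t) {T : MvPolynomial (Fin 3) F} (hT : ι T = algebraMap k K t)
    (htriv : ∀ c : k[X], c ≠ 0 → p.v (Polynomial.aeval (ι (X 0)) c) = 1)
    {P : MvPolynomial (Fin 3) F} (hP : Prime P) (hPv : p.v (ι P) < 1)
    {f : MvPolynomial (Fin 3) F} (hf : p.v (ι f) < 1) : P ∣ f := by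
  by_contra hPf
  let I : Ideal (MvPolynomial (Fin 3) F) :=
    { carrier := {u | p.v (ι u) < 1}
      add_mem' := fun {a b} ha hb => by
        change p.v (ι (a + b)) < 1
        rw [map_add]; exact p.v.map_add_lt ha hb
      zero_mem' := by simp
      smul_mem' := fun c a ha => by
        change p.v (ι (c * a)) < 1
        rw [map_mul, map_mul]
        rw [mul_comm]
        exact mul_lt_one_of_lt_of_le ha (hreg c) }
  let J : Ideal (MvPolynomial (Fin 3) F) := Ideal.span {P}
  have : J.IsPrime := (Ideal.span_singleton_prime hP.ne_zero).2 hP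
  have hJI : J ≤ I := (Ideal.span_singleton_le_iff_mem _).2 hPv
  let φ : F[X][X] →+* MvPolynomial (Fin 3) F :=
    Polynomial.eval₂RingHom (Polynomial.aeval T : F[X] →ₐ[F] _).toRingHom (X 0)
  have hφ (H : F[X][X]) (hH : φ H ∈ I) : H = 0 := by
    have hinj : Function.Injective (Polynomial.aeval t : F[X] →ₐ[F] k).toRingHom :=
      transcendental_iff_injective.1 ht
    by_contra hne
    have h1 := htriv (H.map (Polynomial.aeval t : F[X] →ₐ[F] k).toRingHom)
      (by rwa [Ne, Polynomial.map_eq_zero_iff hinj])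
    refine (ne_of_lt (show p.v (ι (φ H)) < 1 from hH)) ?_
    rw [← h1]
    congr 1
    rw [Polynomial.aeval_def, Polynomial.eval₂_map, Polynomial.coe_eval₂RingHom,
      Polynomial.hom_eval₂]
    congr 1
    refine Polynomial.ringHom_ext (fun a => ?_) ?_
    · simp only [RingHom.comp_apply, AlgHom.toRingHom_eq_coe, RingHom.coe_coe, Polynomial.aeval_C,
        ← IsScalarTower.algebraMap_apply]
    · simp [hT]
  have h1 := eq_zero_of_eval₂_mem φ hJI hφ (c := f) hf (by rwa [Ideal.mem_span_singleton])
  have h2 := eq_zero_of_eval₂_mem (Polynomial.eval₂RingHom φ f) (I := J) (J := ⊥) bot_le h1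
    (c := P) (Ideal.mem_span_singleton_self P) (by simpa using hP.ne_zero)
  refine not_injective_of_four_variables (F := F)
    { Polynomial.eval₂RingHom (Polynomial.eval₂RingHom φ f) P with
      commutes' := fun a => ?_ } ((injective_iff_map_eq_zero _).2 fun H hH => h2 H hH)
  simp [Polynomial.algebraMap_apply, φ]

variable [CharZero k] [IsFractionRing (MvPolynomial (Fin 3) F) K]

/-- The key local statement: polynomials without common factor cannot vanish to high order along
a place. -/
lemma IsE8Place.false_of_vanishesTo {t : k} (h : IsE8Place p t (ι (X 0)) (ι (X 1)) (ι (X 2)))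
    (ht : Transcendental F t)
    (hk : ∀ c : k, ∃ b : k, b ≠ 0 ∧ ∃ e u : MvPolynomial (Fin 3) F,
      ι e = algebraMap k K b ∧ ι u = algebraMap k K b * algebraMap k K c)
    (hnt : ∃ f : K, f ≠ 0 ∧ p.v f < 1)
    {f : Fin 3 → MvPolynomial (Fin 3) F} (hcop : ¬ ∃ P, Prime P ∧ ∀ i, P ∣ f i) {n : ℕ}
    (hn : ∀ i, ι (f i) ∈ weightSpan k (ι (X 0)) (ι (X 1)) (ι (X 2)) (n + 1))
    (hmin : ¬ ∀ i, ι (f i) ∈ weightSpan k (ι (X 0)) (ι (X 1)) (ι (X 2)) n)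
    (hord : ∀ i, VanishesTo p.v ((n + 1 : ℕ) * p.a + 1) (ι (f i))) : False := by
  have hinj : Function.Injective ι := IsFractionRing.injective _ _
  rcases h.regular_or_mem_weightSpan with ⟨hx, hy, hz⟩ | hmem
  swap
  · exact hmin fun i => hmem n _ (hn i) (hord i)
  have hreg (u : MvPolynomial (Fin 3) F) : p.v (ι u) ≤ 1 := by
    refine VanishesTo.zero_iff.1 (PoissonPlace.ord_algebraMap_mvPolynomial (fun i => ?_) u)
    fin_cases i
    exacts [hx, hy, hz]
  by_cases htriv : ∀ c : k[X], c ≠ 0 → p.v (Polynomial.aeval (ι (X 0)) c) = 1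
  · obtain ⟨g, hg0, hg⟩ := hnt
    obtain ⟨u, w, hw, rfl⟩ := IsFractionRing.div_surjective (A := MvPolynomial (Fin 3) F) g
    have hw0 : ι w ≠ 0 := IsFractionRing.to_map_ne_zero_of_mem_nonZeroDivisors hw
    have hu0 : ι u ≠ 0 := fun h0 => hg0 (by rw [h0, zero_div])
    have hu : p.v (ι u) < 1 := by
      rw [← div_mul_cancel₀ (ι u) hw0, map_mul]
      exact mul_lt_one_of_lt_of_le hg (hreg w)
    obtain ⟨N, hN⟩ := exists_mem_weightSpan k (K := K) u
    have ha := h.a_nonneg hx hy hz htriv hN hu0 (VanishesTo.one_iff.2 hu)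
    have hf (i : Fin 3) : p.v (ι (f i)) < 1 :=
      VanishesTo.one_iff.1 ((hord i).mono (by nlinarith))
    obtain ⟨P, hP, -, hPv⟩ := exists_prime_dvd_of_valuation_lt_one hreg
      (fun h0 => hu0 (by rw [h0, map_zero])) hu
    refine hcop ⟨P, hP, fun i => dvd_of_valuation_lt_one hreg ht
      (T := X 0 ^ 5 + X 1 ^ 3 + X 2 ^ 2) ?_ htriv hP hPv (hf i)⟩
    simpa using h.eqn
  · push Not at htriv
    obtain ⟨c, hc0, hc⟩ := htriv
    have hc1 : VanishesTo p.v 1 (Polynomial.aeval (ι (X 0)) c) :=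
      VanishesTo.one_iff.2 (lt_of_le_of_ne
        (VanishesTo.zero_iff.1 (PoissonPlace.ord_aeval hx c)) hc)
    let _ : Algebra k[X] K := (Polynomial.aeval (ι (X 0))).toAlgebra
    obtain ⟨π, hπp, -, hπ⟩ := exists_prime_dvd_of_valuation_lt_one (A := k[X]) (v := p.v)
      (fun c => VanishesTo.zero_iff.1 (PoissonPlace.ord_aeval hx c)) hc0 (VanishesTo.one_iff.1 hc1)
    replace hπ : VanishesTo p.v 1 (Polynomial.aeval (ι (X 0)) π) := VanishesTo.one_iff.2 hπ
    exact hcop (exists_prime_dvd_of_eq_mul hk hreg (h.aeval_ne_zero (by simp) hπp.irreducible) hπ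
      fun i => (h.isChart hx hy hz).exists_factor hπp.irreducible hπ (hn i) (hord i))

end localContradiction

section plane

lemma mem_weightSpan_zero {k K : Type*} [Field k] [Field K] [Algebra k K] {x y z f : K}
    (hf : f ∈ weightSpan k x y z 0) : ∃ c : k, f = algebraMap k K c := by
  induction hf using Submodule.span_induction with
  | mem f hf =>
    obtain ⟨i, j, l, h, rfl⟩ := hf
    obtain ⟨rfl, rfl, rfl⟩ : i = 0 ∧ j = 0 ∧ l = 0 := by omega
    exact ⟨1, by simp⟩
  | zero => exact ⟨0, by simp⟩
  | add f g _ _ hf hg =>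
    obtain ⟨c, rfl⟩ := hf
    obtain ⟨d, rfl⟩ := hg
    exact ⟨c + d, by simp⟩
  | smul a f _ hf =>
    obtain ⟨c, rfl⟩ := hf
    exact ⟨a * c, by simp [Algebra.smul_def]⟩

/-- Fractions can be brought to a common denominator without common factors. -/
lemma exists_common_denominator {A K : Type*} [CommRing A] [IsDomain A]
    [UniqueFactorizationMonoid A] [Field K] [Algebra A K] [IsFractionRing A K] (g h : K) :
    ∃ f : Fin 3 → A, f 0 ≠ 0 ∧ algebraMap A K (f 1) = g * algebraMap A K (f 0) ∧
      algebraMap A K (f 2) = h * algebraMap A K (f 0) ∧ ¬ ∃ P, Prime P ∧ ∀ i, P ∣ f i := by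
  let S : Set A := {b | b ≠ 0 ∧ ∃ a c, algebraMap A K a = g * algebraMap A K b ∧
    algebraMap A K c = h * algebraMap A K b}
  have hS : S.Nonempty := by
    obtain ⟨a, b, hb, rfl⟩ := IsFractionRing.div_surjective (A := A) g
    obtain ⟨c, d, hd, rfl⟩ := IsFractionRing.div_surjective (A := A) h
    have hb0 : algebraMap A K b ≠ 0 := IsFractionRing.to_map_ne_zero_of_mem_nonZeroDivisors hb
    have hd0 : algebraMap A K d ≠ 0 := IsFractionRing.to_map_ne_zero_of_mem_nonZeroDivisors hd
    refine ⟨b * d, mul_ne_zero (nonZeroDivisors.ne_zero hb) (nonZeroDivisors.ne_zero hd),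
      a * d, c * b, ?_, ?_⟩
    · simp only [map_mul]; field_simp
    · simp only [map_mul]; field_simp
  obtain ⟨b, ⟨hb, a, c, ha, hc⟩, hmin⟩ :=
    (IsWellFounded.wf (r := DvdNotUnit (α := A))).has_min S hS
  refine ⟨![b, a, c], hb, ha, hc, ?_⟩
  rintro ⟨P, hP, hdvd⟩
  obtain ⟨b', rfl⟩ : P ∣ b := hdvd 0
  obtain ⟨a', rfl⟩ : P ∣ a := hdvd 1
  obtain ⟨c', rfl⟩ : P ∣ c := hdvd 2
  have hP0 : algebraMap A K P ≠ 0 := (map_ne_zero_iff _ (IsFractionRing.injective A K)).2 hP.ne_zero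
  refine hmin b' ⟨right_ne_zero_of_mul hb, a', c', ?_, ?_⟩
    ⟨right_ne_zero_of_mul hb, P, hP.not_isUnit, mul_comm _ _⟩
  · refine mul_left_cancel₀ hP0 ?_
    rw [map_mul, map_mul] at ha
    linear_combination ha
  · refine mul_left_cancel₀ hP0 ?_
    rw [map_mul, map_mul] at hc
    linear_combination hc

variable {F k K : Type*} [Field F] [Field k] [Field K]
  [Algebra k K] [Algebra (MvPolynomial (Fin 3) F) K] [Algebra F k] [Algebra F K]
  [IsScalarTower F k K] [IsScalarTower F (MvPolynomial (Fin 3) F) K]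
  [IsFractionRing (MvPolynomial (Fin 3) F) K]

local notation "ι" => algebraMap (MvPolynomial (Fin 3) F) K

lemma derivation_eq_zero_of_forall_X {D : Derivation k K K} (hD : ∀ i, D (ι (X i)) = 0) :
    D = 0 := by
  have h1 (u : MvPolynomial (Fin 3) F) : D (ι u) = 0 := by
    induction u using MvPolynomial.induction_on with
    | C a =>
      rw [← MvPolynomial.algebraMap_eq, ← IsScalarTower.algebraMap_apply,
        IsScalarTower.algebraMap_apply F k K, D.map_algebraMap]
    | add f g hf hg => rw [map_add, map_add, hf, hg, add_zero]
    | mul_X f i hf => rw [map_mul, D.leibniz, hf, hD i, smul_zero, smul_zero, add_zero]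
  ext f
  obtain ⟨u, w, hw, rfl⟩ := IsFractionRing.div_surjective (A := MvPolynomial (Fin 3) F) f
  have hw0 : ι w ≠ 0 := IsFractionRing.to_map_ne_zero_of_mem_nonZeroDivisors hw
  have h2 := h1 u
  rw [← div_mul_cancel₀ (ι u) hw0, D.leibniz, h1 w, smul_zero, zero_add, smul_eq_mul] at h2
  exact (mul_eq_zero.1 h2).resolve_left hw0

variable [CharZero k] {t : k}

lemma exists_jacobianBracket_eq_mul {D₁ D₂ : Derivation k K K}
    (heqn : ι (X 0) ^ 5 + ι (X 1) ^ 3 + ι (X 2) ^ 2 = algebraMap k K t)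
    (hD : ∃ f, jacobianBracket D₁ D₂ f ≠ 0) :
    ∃ J : K, J ≠ 0 ∧ jacobianBracket D₁ D₂ (ι (X 0)) (ι (X 1)) = J * (2 * ι (X 2)) ∧
      jacobianBracket D₁ D₂ (ι (X 2)) (ι (X 0)) = J * (3 * ι (X 1) ^ 2) ∧
      jacobianBracket D₁ D₂ (ι (X 1)) (ι (X 2)) = J * (5 * ι (X 0) ^ 4) := by
  have : CharZero K := charZero_of_injective_algebraMap (algebraMap k K).injective
  have hz : ι (X 2) ≠ 0 := by simp
  have hder (D : Derivation k K K) : 5 * ι (X 0) ^ 4 * D (ι (X 0)) + 3 * ι (X 1) ^ 2 * D (ι (X 1)) +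
      2 * ι (X 2) * D (ι (X 2)) = 0 := by
    have h1 := congrArg D heqn
    rw [D.map_algebraMap, map_add, map_add, D.leibniz_pow, D.leibniz_pow, D.leibniz_pow] at h1
    simp only [smul_eq_mul, nsmul_eq_mul] at h1
    linear_combination h1
  have h1 := hder D₁
  have h2 := hder D₂
  set B := jacobianBracket D₁ D₂ with hB
  obtain ⟨J, hJ⟩ : ∃ J, B (ι (X 0)) (ι (X 1)) = J * (2 * ι (X 2)) :=
    ⟨B (ι (X 0)) (ι (X 1)) / (2 * ι (X 2)), by field_simp⟩
  have h2z : (2 * ι (X 2)) ≠ 0 := mul_ne_zero two_ne_zero hz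
  have hzx : B (ι (X 2)) (ι (X 0)) = J * (3 * ι (X 1) ^ 2) := by
    refine mul_left_cancel₀ h2z ?_
    rw [hB, jacobianBracket_apply] at hJ ⊢
    linear_combination 3 * ι (X 1) ^ 2 * hJ + D₂ (ι (X 0)) * h1 - D₁ (ι (X 0)) * h2
  have hyz : B (ι (X 1)) (ι (X 2)) = J * (5 * ι (X 0) ^ 4) := by
    refine mul_left_cancel₀ h2z ?_
    rw [hB, jacobianBracket_apply] at hJ ⊢
    linear_combination 5 * ι (X 0) ^ 4 * hJ + D₁ (ι (X 1)) * h2 - D₂ (ι (X 1)) * h1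
  refine ⟨J, ?_, hJ, hzx, hyz⟩
  rintro rfl
  rw [zero_mul] at hJ hzx hyz
  have anti (f g : K) : B f g = -B g f := by
    simp only [hB, jacobianBracket_apply]; ring
  have self (f : K) : B f f = 0 := by
    simp only [hB, jacobianBracket_apply]; ring
  have hX (i : Fin 3) : B (ι (X i)) = 0 := by
    refine derivation_eq_zero_of_forall_X (F := F) fun j => ?_
    fin_cases i <;> fin_cases j
    exacts [self _, hJ, by rw [anti]; simpa using hzx, by rw [anti]; simpa using hJ, self _, hyz,
      hzx, by rw [anti]; simpa using hyz, self _]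
  obtain ⟨f, hf⟩ := hD
  refine hf (derivation_eq_zero_of_forall_X (F := F) fun j => ?_)
  rw [anti, hX, Derivation.zero_apply, neg_zero]

end plane

section plane

variable {F k K : Type*} [Field F] [Field k] [Field K]
  [Algebra k K] [Algebra (MvPolynomial (Fin 3) F) K] [Algebra F k] [Algebra F K]
  [IsScalarTower F k K] [IsScalarTower F (MvPolynomial (Fin 3) F) K]
  [IsFractionRing (MvPolynomial (Fin 3) F) K] [CharZero k] {t : k}

local notation "ι" => algebraMap (MvPolynomial (Fin 3) F) K

/-- The generic fibre of `x ^ 5 + y ^ 3 + z ^ 2` is not a plane up to birational equivalence. -/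
lemma not_isFractionRing_plane [Algebra (MvPolynomial (Fin 2) k) K]
    [IsScalarTower k (MvPolynomial (Fin 2) k) K] [IsFractionRing (MvPolynomial (Fin 2) k) K]
    (heqn : ι (X 0) ^ 5 + ι (X 1) ^ 3 + ι (X 2) ^ 2 = algebraMap k K t) (ht : Transcendental F t)
    (hk : ∀ c : k, ∃ b : k, b ≠ 0 ∧ ∃ e u : MvPolynomial (Fin 3) F,
      ι e = algebraMap k K b ∧ ι u = algebraMap k K b * algebraMap k K c) : False := by
  let σ := algebraMap (MvPolynomial (Fin 2) k) K
  have hσ : Function.Injective σ := IsFractionRing.injective _ _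
  obtain ⟨D₁, h₁⟩ := exists_derivation_of_isFractionRing (K := K)
    ((Algebra.linearMap (MvPolynomial (Fin 2) k) K).compDer (pderiv 0 : Derivation k _ _))
  obtain ⟨D₂, h₂⟩ := exists_derivation_of_isFractionRing (K := K)
    ((Algebra.linearMap (MvPolynomial (Fin 2) k) K).compDer (pderiv 1 : Derivation k _ _))
  replace h₁ (r : MvPolynomial (Fin 2) k) : D₁ (σ r) = σ (pderiv 0 r) := h₁ r
  replace h₂ (r : MvPolynomial (Fin 2) k) : D₂ (σ r) = σ (pderiv 1 r) := h₂ r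
  have hB : ∃ f, jacobianBracket D₁ D₂ f ≠ 0 := by
    refine ⟨σ (X 0), fun h0 => ?_⟩
    have h3 := congrArg (fun D : Derivation k K K => D (σ (X 1))) h0
    simp [jacobianBracket_apply, h₁, h₂] at h3
  obtain ⟨J, hJ0, hxy, hzx, hyz⟩ := exists_jacobianBracket_eq_mul heqn hB
  obtain ⟨f, hf0, hf1, hf2, hcop⟩ :=
    exists_common_denominator (A := MvPolynomial (Fin 3) F) (σ (X 0)) (σ (X 1))
  have hf0' : ι (f 0) ≠ 0 := (map_ne_zero_iff _ (IsFractionRing.injective _ K)).2 hf0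
  obtain ⟨n, hn, hmin⟩ : ∃ n,
      (∀ i, ι (f i) ∈ weightSpan k (ι (X 0)) (ι (X 1)) (ι (X 2)) (n + 1)) ∧
      ¬ ∀ i, ι (f i) ∈ weightSpan k (ι (X 0)) (ι (X 1)) (ι (X 2)) n := by
    have hex : ∃ n, ∀ i, ι (f i) ∈ weightSpan k (ι (X 0)) (ι (X 1)) (ι (X 2)) n := by
      choose N hN using fun i => exists_mem_weightSpan k (K := K) (f i)
      exact ⟨Finset.univ.sup N, fun i =>
        weightSpan_mono (Finset.le_sup (f := N) (Finset.mem_univ i)) (hN i)⟩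
    classical
    have hfind := Nat.find_spec hex
    rcases hm : Nat.find hex with _ | n
    · rw [hm] at hfind
      obtain ⟨c, hc⟩ := mem_weightSpan_zero (hfind 0)
      obtain ⟨d, hd⟩ := mem_weightSpan_zero (hfind 1)
      have h3 : X 0 * C c = (C d : MvPolynomial (Fin 2) k) := by
        apply hσ
        rw [map_mul, ← MvPolynomial.algebraMap_eq, ← IsScalarTower.algebraMap_apply,
          ← IsScalarTower.algebraMap_apply, ← hc, ← hd, hf1]
      have h4 := congrArg (pderiv (0 : Fin 2)) h3
      simp [Derivation.leibniz] at h4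
      rw [h4, map_zero] at hc
      exact absurd hc hf0'
    · rw [hm] at hfind
      exact ⟨n, hfind, Nat.find_min hex (by omega)⟩
  have hplace (p : PoissonPlace k K) (hp : p.bracket = jacobianBracket D₁ D₂)
      (hnt : ∃ f : K, f ≠ 0 ∧ p.v f < 1) {ω : ℤ} (hω : p.v J = WithZero.exp (-ω))
      (hord : ∀ i, VanishesTo p.v ((n + 1 : ℕ) * (p.a + ω) + 1) (ι (f i))) : False := by
    have hinv : VanishesTo p.v (-ω) J⁻¹ := by
      unfold VanishesTo
      rw [map_inv₀, hω, ← WithZero.exp_neg]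
    refine IsE8Place.false_of_vanishesTo (p := p.scale J⁻¹ ω hinv) (t := t) ⟨heqn, ?_, ?_, ?_, ?_⟩
      ht hk hnt hcop hn hmin hord
    · change J⁻¹ * p.bracket _ _ = _
      rw [hp, hxy, inv_mul_cancel_left₀ hJ0]
    · change J⁻¹ * p.bracket _ _ = _
      rw [hp, hzx, inv_mul_cancel_left₀ hJ0]
    · change J⁻¹ * p.bracket _ _ = _
      rw [hp, hyz, inv_mul_cancel_left₀ hJ0]
    · rintro rfl
      exact ht isAlgebraic_zero
  obtain ⟨a, b, hab, hΦ⟩ := IsFractionRing.exists_reduced_fraction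
    (A := MvPolynomial (Fin 2) k) (J ^ (n + 1) / ι (f 0))
  have hb0 : σ b ≠ 0 := IsFractionRing.to_map_ne_zero_of_mem_nonZeroDivisors b.2
  have hΦ' : ι (f 0) * σ a = J ^ (n + 1) * σ b := by
    rw [IsFractionRing.mk'_eq_div, div_eq_div_iff hb0 hf0'] at hΦ
    linear_combination hΦ
  have hJpow {v : Valuation K ℤᵐ⁰} {ω : ℤ} (hω : v J = WithZero.exp (-ω)) :
      VanishesTo v ((n + 1 : ℕ) * ω) (J ^ (n + 1)) := by
    unfold VanishesTo
    rw [map_pow, hω, ← WithZero.exp_nsmul]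
    simp
  by_cases hbu : IsUnit (b : MvPolynomial (Fin 2) k)
  · obtain ⟨p, hp, ha, hv⟩ := exists_poissonPlace_totalDegree h₁ h₂
    obtain ⟨ω, hω⟩ := VanishesTo.exists_exact (v := p.v) hJ0
    have hone (r : MvPolynomial (Fin 2) k) (hr : r ≠ 0) (hdeg : r.totalDegree = 0) :
        VanishesTo p.v 0 (σ r) := by
      rw [VanishesTo.zero_iff, hv r hr, hdeg]; simp
    have hX (i : Fin 2) : VanishesTo p.v (-1) (σ (X i)) := by
      unfold VanishesTo
      rw [hv _ (X_ne_zero i), totalDegree_X]; simp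
    have hdeg : (b : MvPolynomial (Fin 2) k).totalDegree = 0 := by
      obtain ⟨c, -, hc⟩ := MvPolynomial.isUnit_iff_eq_C_of_isReduced.1 hbu
      rw [hc, totalDegree_C]
    have ha0 : a ≠ 0 := by
      rintro rfl
      rw [map_zero, mul_zero] at hΦ'
      exact mul_ne_zero (pow_ne_zero _ hJ0) hb0 hΦ'.symm
    have h0 : VanishesTo p.v ((n + 1 : ℕ) * ω) (ι (f 0)) := by
      have h3 : VanishesTo p.v ((n + 1 : ℕ) * ω + 0) (ι (f 0) * σ a) := by
        rw [hΦ']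
        exact (hJpow hω).mul (hone _ (nonZeroDivisors.ne_zero b.2) hdeg)
      have h4 := (VanishesTo.mul_exact_iff (f := ι (f 0)) (r := (n + 1 : ℕ) * ω + a.totalDegree)
        (s := -a.totalDegree) (by rw [hv a ha0, neg_neg])).1 (h3.mono (by simp))
      exact h4.mono (by simp)
    refine hplace p hp ⟨(σ (X 0))⁻¹, by simp [σ], ?_⟩ hω fun i => ?_
    · rw [map_inv₀, hv _ (X_ne_zero 0), totalDegree_X, ← WithZero.exp_neg, ← WithZero.exp_zero,
        WithZero.exp_lt_exp]
      simp
    · rw [ha]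
      fin_cases i
      · exact h0.mono (by push_cast; linarith)
      · change VanishesTo p.v _ (ι (f 1))
        rw [hf1]
        exact ((hX 0).mul h0).mono (by push_cast; linarith)
      · change VanishesTo p.v _ (ι (f 2))
        rw [hf2]
        exact ((hX 1).mul h0).mono (by push_cast; linarith)
  · obtain ⟨q, hq, hqb⟩ := WfDvdMonoid.exists_irreducible_factor hbu
      (nonZeroDivisors.ne_zero b.2)
    obtain ⟨p, hp, ha, hv⟩ := exists_poissonPlace_of_prime (K := K) (B := jacobianBracket D₁ D₂)
      (fun f g => by simp only [jacobianBracket_apply]; ring)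
      (fun f => by simp only [jacobianBracket_apply]; ring)
      (fun r s => ⟨pderiv 0 r * pderiv 1 s - pderiv 1 r * pderiv 0 s, by
        rw [jacobianBracket_apply, h₁, h₁, h₂, h₂]; simp [σ]⟩) hq.prime
    obtain ⟨ω, hω⟩ := VanishesTo.exists_exact (v := p.v) hJ0
    have hreg (r : MvPolynomial (Fin 2) k) : VanishesTo p.v 0 (σ r) :=
      mod_cast (hv 0 r).2 (by simp)
    have hone {r : MvPolynomial (Fin 2) k} (hr : q ∣ r) : VanishesTo p.v 1 (σ r) :=
      mod_cast (hv 1 r).2 (by simpa using hr)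
    have hunit : p.v (σ a) = 1 := by
      refine le_antisymm (VanishesTo.zero_iff.1 (hreg a)) (le_of_not_gt fun h3 => ?_)
      have h4 := (hv 1 a).1 (mod_cast VanishesTo.one_iff.2 h3)
      rw [pow_one] at h4
      exact hq.not_isUnit (hab h4 hqb)
    have h0 : VanishesTo p.v ((n + 1 : ℕ) * ω + 1) (ι (f 0)) := by
      refine VanishesTo.of_mul_unit hunit ?_
      rw [hΦ']
      exact (hJpow hω).mul (hone hqb)
    refine hplace p hp ⟨σ q, (map_ne_zero_iff _ hσ).2 hq.ne_zero,
      VanishesTo.one_iff.1 (hone dvd_rfl)⟩ hω fun i => ?_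
    rw [ha, zero_add]
    fin_cases i
    · exact h0
    · change VanishesTo p.v _ (ι (f 1))
      rw [hf1]
      exact (hreg _).mul_left h0
    · change VanishesTo p.v _ (ι (f 2))
      rw [hf2]
      exact (hreg _).mul_left h0

end plane

section rationality

open Cardinal Algebra

universe u

variable {F L : Type u} [Field F] [Field L] [Algebra F L]

lemma isAlgebraic_of_adjoin_eq_top {S : Set L} (hS : IntermediateField.adjoin F S = ⊤) :
    Algebra.IsAlgebraic (Algebra.adjoin F S) L := by
  have : IsFractionRing (Algebra.adjoin F S) L := .of_field _ _ fun z => by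
    obtain ⟨r, hr, s, hs, h⟩ := IntermediateField.mem_adjoin_iff_div.1
      (hS ▸ IntermediateField.mem_top : z ∈ IntermediateField.adjoin F S)
    exact ⟨⟨r, hr⟩, ⟨s, hs⟩, h⟩
  exact IsLocalization.isAlgebraic _ (nonZeroDivisors (Algebra.adjoin F S))

open scoped IntermediateField.algebraAdjoinAdjoin in
lemma trdeg_adjoin_simple_le_one (x : L) : trdeg F (IntermediateField.adjoin F {x}) ≤ 1 := by
  rw [← trdeg_add_eq F (Algebra.adjoin F {x}) (A := IntermediateField.adjoin F {x}),
    trdeg_eq_zero (R := Algebra.adjoin F {x}), add_zero,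
    ← Polynomial.trdeg_of_isDomain (R := F)]
  let e := Subalgebra.equivOfEq _ _ (Algebra.adjoin_singleton_eq_range_aeval F x).symm
  exact trdeg_le_of_surjective (e.toAlgHom.comp (Polynomial.aeval x).rangeRestrict)
    (e.surjective.comp (Polynomial.aeval x).rangeRestrict_surjective)

lemma trdeg_eq_three [Algebra (MvPolynomial (Fin 3) F) L]
    [IsScalarTower F (MvPolynomial (Fin 3) F) L] [IsFractionRing (MvPolynomial (Fin 3) F) L] :
    trdeg F L = 3 := by
  have : Algebra.IsAlgebraic (MvPolynomial (Fin 3) F) L :=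
    IsLocalization.isAlgebraic _ (nonZeroDivisors _)
  have : FaithfulSMul (MvPolynomial (Fin 3) F) L :=
    (faithfulSMul_iff_algebraMap_injective _ _).2 (IsFractionRing.injective _ _)
  rw [← trdeg_add_eq F (MvPolynomial (Fin 3) F), trdeg_eq_zero (R := MvPolynomial (Fin 3) F),
    add_zero, MvPolynomial.trdeg_of_isDomain]
  simp

lemma transcendental_and_algebraicIndependent (hL : trdeg F L = 3) {x g h : L}
    (hgen : IntermediateField.adjoin F {x, g, h} = ⊤) :
    Transcendental F x ∧
    IntermediateField.adjoin (IntermediateField.adjoin F {x}) (Set.range ![g, h]) = ⊤ ∧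
    AlgebraicIndependent (IntermediateField.adjoin F {x}) ![g, h] := by
  have htop : IntermediateField.adjoin (IntermediateField.adjoin F {x}) (Set.range ![g, h]) =
      ⊤ := by
    apply IntermediateField.restrictScalars_injective F
    rw [IntermediateField.adjoin_adjoin_left, IntermediateField.restrictScalars_top, ← hgen]
    congr 1
    ext w
    simp only [Set.singleton_union, Set.mem_insert_iff, Set.mem_range, Fin.exists_fin_two,
      Set.mem_singleton_iff, Matrix.cons_val_zero, Matrix.cons_val_one, eq_comm (b := w)]
  have halg := isAlgebraic_of_adjoin_eq_top htop
  have hsum := trdeg_add_eq F (IntermediateField.adjoin F {x}) (A := L)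
  rw [hL] at hsum
  have hle : trdeg (IntermediateField.adjoin F {x}) L ≤ 2 := by
    refine (Algebra.IsAlgebraic.trdeg_le_cardinalMk _ (Set.range ![g, h])).trans ?_
    simpa using mk_range_le_lift (f := ![g, h])
  have h1 := trdeg_adjoin_simple_le_one (F := F) x
  obtain ⟨a, ha⟩ := Cardinal.lt_aleph0.1 (h1.trans_lt one_lt_aleph0)
  obtain ⟨b, hb⟩ := Cardinal.lt_aleph0.1 (hle.trans_lt (ofNat_lt_aleph0))
  rw [ha] at hsum h1
  rw [hb] at hsum hle
  norm_cast at hsum h1 hle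
  refine ⟨fun hx => ?_, htop, ?_⟩
  · have := IntermediateField.isAlgebraic_adjoin_simple hx.isIntegral
    rw [trdeg_eq_zero] at ha
    norm_cast at ha
    omega
  · refine (Algebra.IsAlgebraic.isTranscendenceBasis_of_lift_le_trdeg_of_finite _ _ ?_).1
    rw [hb]
    simp
    omega

end rationality

section rationality

/-- Elements of a simple extension generated by an integral element are fractions of integral
elements. -/
lemma exists_denominator_of_adjoin_simple {F A K : Type*} [Field F] [CommRing A] [Field K]
    [Algebra F A] [Algebra F K] [Algebra A K] [IsScalarTower F A K] (e : A)
    (c : IntermediateField.adjoin F {algebraMap A K e}) :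
    ∃ b : IntermediateField.adjoin F {algebraMap A K e}, b ≠ 0 ∧ ∃ s r : A,
      algebraMap A K s = algebraMap _ K b ∧
      algebraMap A K r = algebraMap _ K b * algebraMap _ K c := by
  obtain ⟨r, s, hrs⟩ := (IntermediateField.mem_adjoin_simple_iff F _).1 c.2
  by_cases hs : Polynomial.aeval (algebraMap A K e) s = 0
  · refine ⟨1, one_ne_zero, 1, 0, by simp, ?_⟩
    change _ = _ * (c : K)
    rw [hrs, hs]
    simp
  · refine ⟨⟨Polynomial.aeval (algebraMap A K e) s, IntermediateField.algebra_adjoin_le_adjoin F _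
      (Polynomial.aeval_mem_adjoin_singleton F _)⟩, fun h0 => hs (congrArg Subtype.val h0),
      Polynomial.aeval e s, Polynomial.aeval e r, ?_, ?_⟩
    · exact (Polynomial.aeval_algebraMap_apply K e s).symm
    · change _ = Polynomial.aeval (algebraMap A K e) s * (c : K)
      rw [hrs, mul_div_cancel₀ _ hs]
      exact (Polynomial.aeval_algebraMap_apply K e r).symm

variable {F k K : Type*} [Field F] [Field k] [Field K]
  [Algebra k K] [Algebra (MvPolynomial (Fin 3) F) K] [Algebra F k] [Algebra F K]
  [IsScalarTower F k K] [IsScalarTower F (MvPolynomial (Fin 3) F) K]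
  [IsFractionRing (MvPolynomial (Fin 3) F) K] [CharZero k] {t : k}

local notation "ι" => algebraMap (MvPolynomial (Fin 3) F) K

lemma adjoin_pair_ne_top {g h : K}
    (heqn : ι (X 0) ^ 5 + ι (X 1) ^ 3 + ι (X 2) ^ 2 = algebraMap k K t) (ht : Transcendental F t)
    (hk : ∀ c : k, ∃ b : k, b ≠ 0 ∧ ∃ e u : MvPolynomial (Fin 3) F,
      ι e = algebraMap k K b ∧ ι u = algebraMap k K b * algebraMap k K c)
    (hind : AlgebraicIndependent k ![g, h]) :
    IntermediateField.adjoin k (Set.range ![g, h]) ≠ ⊤ := by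
  intro htop
  let φ : MvPolynomial (Fin 2) k →ₐ[k] K := aeval ![g, h]
  let _ : Algebra (MvPolynomial (Fin 2) k) K := φ.toAlgebra
  have : IsScalarTower k (MvPolynomial (Fin 2) k) K :=
    .of_algebraMap_eq fun c => (φ.commutes c).symm
  have : FaithfulSMul (MvPolynomial (Fin 2) k) K :=
    (faithfulSMul_iff_algebraMap_injective _ _).2 hind
  have : IsFractionRing (MvPolynomial (Fin 2) k) K := .of_field _ _ fun z =>
    (IntermediateField.mem_adjoin_range_iff k _ z).1 (by rw [htop]; exact IntermediateField.mem_top)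
  exact not_isFractionRing_plane heqn ht hk

universe u

/-- The general form of the theorem, over an arbitrary field of characteristic zero. -/
lemma adjoin_triple_ne_top {F K : Type u} [Field F] [CharZero F] [Field K] [Algebra F K]
    [Algebra (MvPolynomial (Fin 3) F) K] [IsScalarTower F (MvPolynomial (Fin 3) F) K]
    [IsFractionRing (MvPolynomial (Fin 3) F) K] {e : MvPolynomial (Fin 3) F}
    (he : X 0 ^ 5 + X 1 ^ 3 + X 2 ^ 2 = e) (g h : K) :
    IntermediateField.adjoin F {algebraMap (MvPolynomial (Fin 3) F) K e, g, h} ≠ ⊤ := by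
  intro hgen
  obtain ⟨ht, htop, hind⟩ := transcendental_and_algebraicIndependent trdeg_eq_three hgen
  let k := IntermediateField.adjoin F {algebraMap (MvPolynomial (Fin 3) F) K e}
  let t : k := IntermediateField.AdjoinSimple.gen F _
  have htK : algebraMap k K t = algebraMap (MvPolynomial (Fin 3) F) K e :=
    IntermediateField.AdjoinSimple.algebraMap_gen F _
  have : CharZero k := charZero_of_injective_algebraMap (algebraMap F k).injective
  have heqn : algebraMap (MvPolynomial (Fin 3) F) K (X 0) ^ 5 +
      algebraMap (MvPolynomial (Fin 3) F) K (X 1) ^ 3 +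
      algebraMap (MvPolynomial (Fin 3) F) K (X 2) ^ 2 = algebraMap k K t := by
    rw [htK, ← he]
    simp only [map_add, map_pow]
  have htk : Transcendental F t :=
    (transcendental_algebraMap_iff (algebraMap k K).injective).1 (by rwa [htK])
  exact adjoin_pair_ne_top heqn htk (exists_denominator_of_adjoin_simple e) hind htop

end rationality

theorem e8_not_rational :
    ¬ ∃ g h : Fxyz,
      IntermediateField.adjoin ℂ {Vx ^ 5 + Vy ^ 3 + Vz ^ 2, g, h} =
        (⊤ : IntermediateField ℂ Fxyz) := by
  rintro ⟨g, h, hgen⟩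
  refine adjoin_triple_ne_top (F := ℂ) rfl g h ?_
  simpa only [Vx, Vy, Vz, map_add, map_pow] using hgen

end
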